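/- The two-way atomic decomposition preserves sometimes-termination of the restricted chase, and may gain it: (i) if a rule set 𝓡 is in CT_R^∃ then 2ad(𝓡) is in CT_R^∃; (ii) there exists a rule set 𝓡 with 𝓡 ∉ CT_R^∃ and 2ad(𝓡) ∈ CT_R^∃ (the set {A(x) → ∃y,z.(R(x,x,x) ∧ R(x,y,z)); R(x,y,z) → ∃t.R(x,x,t); R(x,x,y) → ∃z.S(x,y,z); R(x,x,y) ∧ S(x,y,z) → S(x,x,x); A(x) ∧ S(x,x,y) → A(y)} is such a witness). -/

import Mathlib

namespace ExRules

open scoped Classical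

noncomputable section

/-- Terms: constants or variables, each indexed by a natural number. -/
inductive Term where
  | const : ℕ → Term
  | var : ℕ → Term
deriving DecidableEq

/-- An atom: a predicate symbol applied to a list of terms (the arity of the
predicate is the length of the argument list). -/
structure Atom where
  pred : ℕ
  args : List Term
deriving DecidableEq

/-- A factbase is a finite set of atoms. -/
abbrev FactBase := Finset Atom

/-- A substitution: a map on variables (extended by the identity on constants). -/
abbrev Subst := ℕ → Term

def applyTerm (σ : Subst) : Term → Term
  | .const c => .const c
  | .var v => σ v

def Atom.subst (σ : Subst) (a : Atom) : Atom := ⟨a.pred, a.args.map (applyTerm σ)⟩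

def Term.vars : Term → Finset ℕ
  | .const _ => ∅
  | .var v => {v}

def Atom.vars (a : Atom) : Finset ℕ := a.args.foldr (fun t s => t.vars ∪ s) ∅

def FactBase.vars (F : FactBase) : Finset ℕ := F.sup Atom.vars

/-- The variables occurring in a (possibly infinite) set of atoms. -/
def setVars (S : Set Atom) : Set ℕ := {v | ∃ a ∈ S, v ∈ a.vars}

/-- `σ` is a homomorphism from the atom set `S` to the atom set `S'`. -/
def IsHom (σ : Subst) (S S' : Set Atom) : Prop := ∀ a ∈ S, a.subst σ ∈ S'

/-- A retraction is a homomorphism that is the identity on the common variables. -/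
def IsRetraction (σ : Subst) (S S' : Set Atom) : Prop :=
  IsHom σ S S' ∧ ∀ v, v ∈ setVars S → v ∈ setVars S' → σ v = Term.var v

/-- An existential rule `B → ∃z.H` with nonempty body and head.  The frontier and
the existential variables are determined by the variables shared between body and
head. -/
structure Rule where
  body : Finset Atom
  head : Finset Atom
  body_nonempty : body.Nonempty
  head_nonempty : head.Nonempty

instance : DecidableEq Rule := fun R S =>
  decidable_of_iff (R.body = S.body ∧ R.head = S.head) (by
    constructor
    · rintro ⟨h1, h2⟩
      cases R; cases S; simp_all
    · rintro rfl; exact ⟨rfl, rfl⟩)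

/-- The frontier of a rule: the variables shared by body and head. -/
def Rule.frontier (R : Rule) : Finset ℕ := FactBase.vars R.body ∩ FactBase.vars R.head

/-- The existential variables of a rule: head variables not occurring in the body. -/
def Rule.exVars (R : Rule) : Finset ℕ := FactBase.vars R.head \ FactBase.vars R.body

/-- A rule is Datalog if it has no existential variable. -/
def Rule.IsDatalog (R : Rule) : Prop := R.exVars = ∅

/-- A rule has an atomic head if its head is a single atom. -/
def Rule.IsAtomicHead (R : Rule) : Prop := R.head.card = 1

/-- A rule set is a finite set of existential rules. -/
abbrev RuleSet := Finset Rule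

instance : Encodable Term :=
  Encodable.ofEquiv (ℕ ⊕ ℕ)
    { toFun := fun t => match t with | .const c => .inl c | .var v => .inr v
      invFun := fun s => match s with | .inl c => .const c | .inr v => .var v
      left_inv := by intro t; cases t <;> rfl
      right_inv := by intro s; cases s <;> rfl }

instance : Encodable Atom :=
  Encodable.ofEquiv (ℕ × List Term)
    { toFun := fun a => (a.pred, a.args)
      invFun := fun p => ⟨p.1, p.2⟩
      left_inv := fun _ => rfl
      right_inv := fun _ => rfl }

instance : Encodable Rule :=
  Encodable.ofEquiv {p : Finset Atom × Finset Atom // p.1.Nonempty ∧ p.2.Nonempty}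
    { toFun := fun R => ⟨(R.body, R.head), R.body_nonempty, R.head_nonempty⟩
      invFun := fun p => ⟨p.1.1, p.1.2, p.2.1, p.2.2⟩
      left_inv := fun _ => rfl
      right_inv := fun _ => rfl }

/-- A trigger `(R, π)`: a rule together with a substitution. -/
structure Trigger where
  rule : Rule
  map : Subst

/-- The canonical fresh variable `z_t` associated to a trigger `t` and an
existential variable `z`: it is unique for `z` and (the relevant part of) `t`. -/
def Trigger.freshVar (t : Trigger) (z : ℕ) : ℕ :=
  Nat.pair
    (Encodable.encode (t.rule, ((FactBase.vars t.rule.body).sort (· ≤ ·)).map t.map)) z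

/-- The extension `π_R` of the substitution of a trigger, mapping each existential
variable `z` to the fresh variable `z_t`. -/
def Trigger.ext (t : Trigger) : Subst := fun v =>
  if v ∈ t.rule.exVars then Term.var (t.freshVar v) else t.map v

/-- The output of a trigger: `out(t) = π_R(H)`. -/
def Trigger.out (t : Trigger) : Finset Atom := t.rule.head.image (Atom.subst t.ext)

/-- `t` is a trigger on the factbase `F`: its substitution is a homomorphism from
the body of its rule to `F`. -/
def Trigger.IsOn (t : Trigger) (F : FactBase) : Prop := IsHom t.map ↑t.rule.body ↑F

/-- The chase variants: oblivious, semi-oblivious, restricted, equivalent. -/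
inductive Variant where
  | O | SO | R | E

/-- Applicability of a trigger on a factbase, for each chase variant. -/
def Applicable : Variant → Trigger → FactBase → Prop
  | .O, t, F => ¬ t.out ⊆ F
  | .SO, t, F => ∀ t' : Trigger, t'.rule = t.rule →
      (∀ v ∈ t.rule.frontier, t'.map v = t.map v) → ¬ t'.out ⊆ F
  | .R, t, F => ¬ ∃ σ : Subst, IsRetraction σ ↑(F ∪ t.out) ↑F
  | .E, t, F => ¬ ∃ σ : Subst, IsHom σ ↑(F ∪ t.out) ↑F

/-- An atom set `M` satisfies a rule `B → ∃z.H` if every homomorphism from `B`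
to `M` extends to a homomorphism mapping `H` into `M`. -/
def SatisfiesRule (M : Set Atom) (R : Rule) : Prop :=
  ∀ σ : Subst, IsHom σ ↑R.body M →
    ∃ σ' : Subst, (∀ v ∈ FactBase.vars R.body, σ' v = σ v) ∧ IsHom σ' ↑R.head M

/-- A (finite or infinite) derivation from the knowledge base `⟨𝓡, F⟩`:
`len` is the number of triggers (possibly `⊤`), `fb i` is the `i`-th factbase and,
for `i < len`, `tr i` is the trigger producing `fb (i+1)` from `fb i`. -/
structure Derivation (𝓡 : RuleSet) (F : FactBase) where
  len : ℕ∞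
  fb : ℕ → FactBase
  tr : ℕ → Trigger
  fb_zero : fb 0 = F
  rule_mem : ∀ i : ℕ, (i : ℕ∞) < len → (tr i).rule ∈ 𝓡
  trig_on : ∀ i : ℕ, (i : ℕ∞) < len → (tr i).IsOn (fb i)
  trig_new : ∀ i : ℕ, (i : ℕ∞) < len → ¬ (tr i).out ⊆ fb i
  fb_succ : ∀ i : ℕ, (i : ℕ∞) < len → fb (i + 1) = fb i ∪ (tr i).out
  fb_stall : ∀ i : ℕ, ¬ (i : ℕ∞) < len → fb (i + 1) = fb i

namespace Derivation

variable {𝓡 : RuleSet} {F : FactBase}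

/-- An `X`-derivation: every applied trigger is `X`-applicable when applied. -/
def IsX (X : Variant) (D : Derivation 𝓡 F) : Prop :=
  ∀ i : ℕ, (i : ℕ∞) < D.len → Applicable X (D.tr i) (D.fb i)

/-- Datalog-first: a non-Datalog rule is only applied when all Datalog rules of
the rule set are satisfied. -/
def DatalogFirst (D : Derivation 𝓡 F) : Prop :=
  ∀ i : ℕ, (i : ℕ∞) < D.len → ¬ (D.tr i).rule.IsDatalog →
    ∀ R ∈ 𝓡, R.IsDatalog → SatisfiesRule ↑(D.fb i) R

/-- Fairness: every trigger `X`-applicable on some factbase of the derivation is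
eventually not `X`-applicable. -/
def Fair (X : Variant) (D : Derivation 𝓡 F) : Prop :=
  ∀ i : ℕ, (i : ℕ∞) ≤ D.len → ∀ t : Trigger, t.rule ∈ 𝓡 → t.IsOn (D.fb i) →
    Applicable X t (D.fb i) →
    ∃ j : ℕ, i < j ∧ (j : ℕ∞) ≤ D.len ∧ ¬ Applicable X t (D.fb j)

/-- A derivation is finite if its length is not `⊤`. -/
def Finite (D : Derivation 𝓡 F) : Prop := D.len ≠ ⊤

end Derivation

/-- `CT_X^∀` (non-Datalog-first): every fair `X`-derivation from every KB is finite. -/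
def CTall (X : Variant) (𝓡 : RuleSet) : Prop :=
  ∀ F : FactBase, ∀ D : Derivation 𝓡 F, D.IsX X → D.Fair X → D.Finite

/-- `CT_X^∃`: some fair `X`-derivation from every KB is finite. -/
def CTex (X : Variant) (𝓡 : RuleSet) : Prop :=
  ∀ F : FactBase, ∃ D : Derivation 𝓡 F, D.IsX X ∧ D.Fair X ∧ D.Finite

/-- `CT_{df-X}^∀`: every fair Datalog-first `X`-derivation from every KB is finite. -/
def CTallDF (X : Variant) (𝓡 : RuleSet) : Prop :=
  ∀ F : FactBase, ∀ D : Derivation 𝓡 F, D.IsX X → D.DatalogFirst → D.Fair X → D.Finite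

/-- `CT_{df-X}^∃`: some fair Datalog-first `X`-derivation from every KB is finite. -/
def CTexDF (X : Variant) (𝓡 : RuleSet) : Prop :=
  ∀ F : FactBase, ∃ D : Derivation 𝓡 F, D.IsX X ∧ D.DatalogFirst ∧ D.Fair X ∧ D.Finite

/-! ### Single-piece decomposition -/

/-- Adjacency in the piece graph of a rule: two head atoms sharing an existential
variable. -/
def PieceAdj (R : Rule) (a b : Atom) : Prop :=
  a ∈ R.head ∧ b ∈ R.head ∧ (a.vars ∩ b.vars ∩ R.exVars).Nonempty

/-- The piece (connected component of the piece graph) containing a given head atom. -/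
def pieceOf (R : Rule) (a : Atom) : Finset Atom :=
  R.head.filter fun b => Relation.ReflTransGen (PieceAdj R) a b

theorem self_mem_pieceOf {R : Rule} {a : Atom} (h : a ∈ R.head) : a ∈ pieceOf R a := by
  rw [pieceOf, Finset.mem_filter]
  exact ⟨h, Relation.ReflTransGen.refl⟩

/-- The single-piece decomposition of a rule. -/
def Rule.sp (R : Rule) : Finset Rule :=
  R.head.attach.image fun a =>
    ⟨R.body, pieceOf R a.1, R.body_nonempty, ⟨a.1, self_mem_pieceOf a.2⟩⟩

/-- The single-piece decomposition of a rule set. -/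
def spSet (𝓡 : RuleSet) : RuleSet := 𝓡.biUnion Rule.sp

/-! ### Atomic decompositions -/

/-- The predicates occurring in a rule set. -/
def RuleSet.predsF (𝓡 : RuleSet) : Finset ℕ :=
  𝓡.sup fun R => (R.body.image Atom.pred) ∪ (R.head.image Atom.pred)

/-- A fresh predicate `X_R`, unique for `R` and not occurring in `𝓡`. -/
def freshPred (𝓡 : RuleSet) (R : Rule) : ℕ :=
  (RuleSet.predsF 𝓡).sup id + 1 + Encodable.encode R

/-- The atom `X_R(x, z)` over the fresh predicate, whose arguments are the frontier
variables followed by the existential variables of `R`. -/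
def xAtom (𝓡 : RuleSet) (R : Rule) : Atom :=
  ⟨freshPred 𝓡 R,
    ((R.frontier.sort (· ≤ ·)).map Term.var) ++ ((R.exVars.sort (· ≤ ·)).map Term.var)⟩

/-- The one-way atomic decomposition of a rule `R = B → ∃z.H` (relative to `𝓡`):
the rule `B → ∃z.X_R(x,z)` together with a rule `X_R(x,z) → P(t)` for each head atom. -/
def oneAdRule (𝓡 : RuleSet) (R : Rule) : Finset Rule :=
  insert ⟨R.body, {xAtom 𝓡 R}, R.body_nonempty, Finset.singleton_nonempty _⟩
    (R.head.attach.image fun a =>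
      ⟨{xAtom 𝓡 R}, {a.1}, Finset.singleton_nonempty _, Finset.singleton_nonempty _⟩)

/-- The one-way atomic decomposition of a rule set. -/
def oneAd (𝓡 : RuleSet) : RuleSet := 𝓡.biUnion (oneAdRule 𝓡)

/-- The two-way atomic decomposition: `2ad(R) = 1ad(R) ∪ {H[x,z] → X_R(x,z)}`. -/
def twoAd (𝓡 : RuleSet) : RuleSet :=
  oneAd 𝓡 ∪ 𝓡.image fun R =>
    ⟨R.head, {xAtom 𝓡 R}, R.head_nonempty, Finset.singleton_nonempty _⟩

/-! ### Models, entailment, BDDP -/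

/-- `M` is a model of the rule set `𝓡`. -/
def IsModelOfRules (𝓡 : RuleSet) (M : Set Atom) : Prop := ∀ R ∈ 𝓡, SatisfiesRule M R

/-- `M` is a model of the knowledge base `⟨𝓡, F⟩`. -/
def IsModelOfKB (𝓡 : RuleSet) (F : FactBase) (M : Set Atom) : Prop :=
  IsModelOfRules 𝓡 M ∧ ∃ σ : Subst, IsHom σ ↑F M

/-- `M` is a universal model of `⟨𝓡, F⟩`: a model mapping homomorphically into
every model. -/
def IsUniversalModel (𝓡 : RuleSet) (F : FactBase) (M : Set Atom) : Prop :=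
  IsModelOfKB 𝓡 F M ∧ ∀ N : Set Atom, IsModelOfKB 𝓡 F N → ∃ σ : Subst, IsHom σ M N

/-- An atom set entails a Boolean conjunctive query `Q` if `Q` maps
homomorphically into it. -/
def EntailsQ (S : Set Atom) (Q : Finset Atom) : Prop := ∃ σ : Subst, IsHom σ ↑Q S

/-- `⟨𝓡, F⟩ ⊨ Q`: every model of the KB entails `Q`. -/
def KBEntails (𝓡 : RuleSet) (F : FactBase) (Q : Finset Atom) : Prop :=
  ∀ M : Set Atom, IsModelOfKB 𝓡 F M → EntailsQ M Q

/-- `R(F)`: the minimal atom set including `F` and `out(t)` for every trigger `t`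
with rule `R` on `F`. -/
def ruleStep (R : Rule) (S : Set Atom) : Set Atom :=
  S ∪ {a | ∃ t : Trigger, t.rule = R ∧ IsHom t.map ↑R.body S ∧ a ∈ t.out}

/-- `𝓡(F) = ⋃_{R ∈ 𝓡} R(F)` (together with `F`). -/
def setStep (𝓡 : RuleSet) (S : Set Atom) : Set Atom := S ∪ ⋃ R ∈ 𝓡, ruleStep R S

/-- The breadth-first chase `Ch_i(⟨𝓡, F⟩)`. -/
def ch (𝓡 : RuleSet) (F : FactBase) : ℕ → Set Atom
  | 0 => ↑F
  | i + 1 => setStep 𝓡 (ch 𝓡 F i)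

/-- The bounded derivation depth property. -/
def BDDP (𝓡 : RuleSet) : Prop :=
  ∀ Q : Finset Atom, ∃ k : ℕ, ∀ F : FactBase, KBEntails 𝓡 F Q ↔ EntailsQ (ch 𝓡 F k) Q

/-! ### Conservative extensions -/

/-- The restriction of an atom set to the atoms over a given set of predicates. -/
def restrictTo (M : Set Atom) (P : Set ℕ) : Set Atom := {a ∈ M | a.pred ∈ P}

/-- The terms (domain elements) of an atom set. -/
def termsOf (M : Set Atom) : Set Term := {u | ∃ a ∈ M, u ∈ a.args}

/-- `𝓡'` is a conservative extension of `𝓡`. -/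
def ConservativeExt (𝓡 𝓡' : RuleSet) : Prop :=
  (↑(RuleSet.predsF 𝓡) : Set ℕ) ⊆ ↑(RuleSet.predsF 𝓡') ∧
  (∀ M : Set Atom, IsModelOfRules 𝓡' M →
    IsModelOfRules 𝓡 (restrictTo M ↑(RuleSet.predsF 𝓡))) ∧
  (∀ M : Set Atom, IsModelOfRules 𝓡 M →
    ∃ M' : Set Atom, M ⊆ M' ∧ IsModelOfRules 𝓡' M' ∧ termsOf M' = termsOf M ∧
      restrictTo M' ↑(RuleSet.predsF 𝓡) = restrictTo M ↑(RuleSet.predsF 𝓡))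

/-- `𝓡'` is a universal-conservative extension of `𝓡`. -/
def UnivConservativeExt (𝓡 𝓡' : RuleSet) : Prop :=
  (↑(RuleSet.predsF 𝓡) : Set ℕ) ⊆ ↑(RuleSet.predsF 𝓡') ∧
  ∀ F : FactBase, (∀ a ∈ F, a.pred ∈ RuleSet.predsF 𝓡) →
    (∀ M : Set Atom, IsUniversalModel 𝓡' F M →
      IsUniversalModel 𝓡 F (restrictTo M ↑(RuleSet.predsF 𝓡))) ∧
    (∀ M : Set Atom, IsUniversalModel 𝓡 F M →
      ∃ M' : Set Atom, M ⊆ M' ∧ IsUniversalModel 𝓡' F M' ∧ termsOf M' = termsOf M ∧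
        restrictTo M' ↑(RuleSet.predsF 𝓡) = restrictTo M ↑(RuleSet.predsF 𝓡))

def aA (t : Term) : Atom := ⟨0, [t]⟩
def aR3 (t u v : Term) : Atom := ⟨1, [t, u, v]⟩
def aS3 (t u v : Term) : Atom := ⟨2, [t, u, v]⟩
def vx : Term := Term.var 0
def vy : Term := Term.var 1
def vz : Term := Term.var 2
def vt : Term := Term.var 3

/-- `𝓡 = {A(x) → ∃y,z.(R(x,x,x) ∧ R(x,y,z)); R(x,y,z) → ∃t.R(x,x,t);
  R(x,x,y) → ∃z.S(x,y,z); R(x,x,y) ∧ S(x,y,z) → S(x,x,x);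
  A(x) ∧ S(x,x,y) → A(y)}`. -/
def R13set : RuleSet :=
  { ⟨{aA vx}, {aR3 vx vx vx, aR3 vx vy vz},
      Finset.singleton_nonempty _, Finset.insert_nonempty _ _⟩,
    ⟨{aR3 vx vy vz}, {aR3 vx vx vt}, Finset.singleton_nonempty _, Finset.singleton_nonempty _⟩,
    ⟨{aR3 vx vx vy}, {aS3 vx vy vz}, Finset.singleton_nonempty _, Finset.singleton_nonempty _⟩,
    ⟨{aR3 vx vx vy, aS3 vx vy vz}, {aS3 vx vx vx},
      Finset.insert_nonempty _ _, Finset.singleton_nonempty _⟩,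
    ⟨{aA vx, aS3 vx vx vy}, {aA vy}, Finset.insert_nonempty _ _, Finset.singleton_nonempty _⟩ }

/-! ### Substitutions and variables -/

theorem Atom.mem_vars {a : Atom} {v : ℕ} : v ∈ a.vars ↔ Term.var v ∈ a.args := by
  obtain ⟨p, l⟩ := a
  simp only [Atom.vars]
  induction l with
  | nil => simp
  | cons t l ih =>
    simp only [List.foldr_cons, Finset.mem_union, ih, List.mem_cons]
    cases t <;> simp [Term.vars]

theorem FactBase.mem_vars {F : FactBase} {v : ℕ} :
    v ∈ FactBase.vars F ↔ ∃ a ∈ F, v ∈ a.vars := by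
  simp [FactBase.vars, Finset.mem_sup]

theorem mem_setVars_coe {F : FactBase} {v : ℕ} :
    v ∈ setVars (↑F : Set Atom) ↔ v ∈ FactBase.vars F := by
  simp [setVars, FactBase.mem_vars]

theorem FactBase.vars_mono {F G : FactBase} (h : F ⊆ G) : FactBase.vars F ⊆ FactBase.vars G :=
  Finset.sup_mono h

theorem applyTerm_congr {σ τ : Subst} {u : Term} (h : ∀ v, u = Term.var v → σ v = τ v) :
    applyTerm σ u = applyTerm τ u := by
  cases u with
  | const c => rfl
  | var v => exact h v rfl

theorem applyTerm_eq_self {σ : Subst} {u : Term} (h : ∀ v, u = Term.var v → σ v = Term.var v) :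
    applyTerm σ u = u := by
  cases u with
  | const c => rfl
  | var v => exact h v rfl

theorem Atom.subst_congr {σ τ : Subst} {a : Atom} (h : ∀ v ∈ a.vars, σ v = τ v) :
    a.subst σ = a.subst τ := by
  simp only [Atom.subst, Atom.mk.injEq, true_and]
  refine List.map_congr_left fun u hu => applyTerm_congr fun v hv => h v ?_
  subst hv
  exact Atom.mem_vars.2 hu

theorem Atom.subst_subst (σ τ : Subst) (a : Atom) :
    (a.subst σ).subst τ = a.subst (fun v => applyTerm τ (σ v)) := by
  simp only [Atom.subst, Atom.mk.injEq, true_and, List.map_map]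
  refine List.map_congr_left fun u _ => ?_
  cases u <;> rfl

theorem Atom.subst_var (a : Atom) : a.subst Term.var = a := by
  obtain ⟨p, l⟩ := a
  simp only [Atom.subst, Atom.mk.injEq, true_and]
  exact (List.map_congr_left fun u _ => applyTerm_eq_self fun _ _ => rfl).trans (List.map_id _)

theorem Atom.subst_eq_self {σ : Subst} {a : Atom} (h : ∀ v ∈ a.vars, σ v = Term.var v) :
    a.subst σ = a :=
  (Atom.subst_congr h).trans a.subst_var

theorem Atom.mem_vars_subst {σ : Subst} {a : Atom} {w : ℕ} :
    w ∈ (a.subst σ).vars ↔ ∃ v ∈ a.vars, σ v = Term.var w := by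
  simp only [Atom.mem_vars, Atom.subst, List.mem_map]
  constructor
  · rintro ⟨u, hu, h⟩
    cases u with
    | const c => simp [applyTerm] at h
    | var v => exact ⟨v, hu, h⟩
  · rintro ⟨v, hv, h⟩
    exact ⟨_, hv, h⟩

theorem IsHom.mono {σ : Subst} {S S' T : Set Atom} (h : IsHom σ S S') (hS : S' ⊆ T) :
    IsHom σ S T := fun a ha => hS (h a ha)

theorem IsHom.congr {σ τ : Subst} {B : Finset Atom} {S : Set Atom} (h : IsHom σ ↑B S)
    (hστ : ∀ v ∈ FactBase.vars B, τ v = σ v) : IsHom τ ↑B S := by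
  intro a ha
  rw [Atom.subst_congr fun v hv => hστ v (FactBase.mem_vars.2 ⟨a, ha, hv⟩)]
  exact h a ha

theorem IsHom.var_mem {σ : Subst} {B F : FactBase} (h : IsHom σ (↑B : Set Atom) ↑F) {v w : ℕ}
    (hv : v ∈ FactBase.vars B) (hw : σ v = Term.var w) : w ∈ FactBase.vars F := by
  obtain ⟨a, ha, hav⟩ := FactBase.mem_vars.1 hv
  exact FactBase.mem_vars.2 ⟨_, h a ha, Atom.mem_vars_subst.2 ⟨v, hav, hw⟩⟩

theorem Rule.mem_exVars {R : Rule} {z : ℕ} :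
    z ∈ R.exVars ↔ z ∈ FactBase.vars R.head ∧ z ∉ FactBase.vars R.body :=
  Finset.mem_sdiff

theorem Rule.body_or_exVars {R : Rule} {v : ℕ} (h : v ∈ FactBase.vars R.head) :
    v ∈ FactBase.vars R.body ∨ v ∈ R.exVars := by
  by_cases hb : v ∈ FactBase.vars R.body
  · exact Or.inl hb
  · exact Or.inr (Rule.mem_exVars.2 ⟨h, hb⟩)

/-! ### Triggers -/

theorem Trigger.ext_body {t : Trigger} {v : ℕ} (h : v ∈ FactBase.vars t.rule.body) :
    t.ext v = t.map v :=
  if_neg fun h' => (Rule.mem_exVars.1 h').2 h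

theorem Trigger.ext_exVars {t : Trigger} {v : ℕ} (h : v ∈ t.rule.exVars) :
    t.ext v = Term.var (t.freshVar v) :=
  if_pos h

theorem Trigger.freshVar_inj {t s : Trigger} {z y : ℕ} (h : t.freshVar z = s.freshVar y) :
    t.rule = s.rule ∧ z = y ∧ ∀ v ∈ FactBase.vars t.rule.body, t.map v = s.map v := by
  obtain ⟨R, π⟩ := t
  obtain ⟨R', π'⟩ := s
  simp only [Trigger.freshVar, Nat.pair_eq_pair, Encodable.encode_inj, Prod.mk.injEq] at h
  obtain ⟨⟨rfl, h2⟩, h3⟩ := h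
  refine ⟨rfl, h3, fun v hv => ?_⟩
  exact List.map_inj_left.1 h2 v (by simpa using hv)

theorem Trigger.freshVar_congr {t s : Trigger} (hr : t.rule = s.rule)
    (hm : ∀ v ∈ FactBase.vars t.rule.body, t.map v = s.map v) (z : ℕ) :
    t.freshVar z = s.freshVar z := by
  obtain ⟨R, π⟩ := t
  obtain ⟨R', π'⟩ := s
  obtain rfl : R = R' := hr
  have : ((FactBase.vars R.body).sort (· ≤ ·)).map π
      = ((FactBase.vars R.body).sort (· ≤ ·)).map π' :=
    List.map_congr_left fun v hv => hm v (by simpa using hv)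
  simp only [Trigger.freshVar, this]

theorem Trigger.out_congr {t s : Trigger} (hr : t.rule = s.rule)
    (hm : ∀ v ∈ FactBase.vars t.rule.body, t.map v = s.map v) : t.out = s.out := by
  have key : ∀ v ∈ FactBase.vars t.rule.head, t.ext v = s.ext v := by
    intro v hv
    rcases Rule.body_or_exVars hv with h | h
    · rw [Trigger.ext_body h, Trigger.ext_body (hr ▸ h), hm v h]
    · rw [Trigger.ext_exVars h, Trigger.ext_exVars (hr ▸ h), Trigger.freshVar_congr hr hm]
  rw [Trigger.out, Trigger.out, ← hr]
  refine Finset.image_congr fun a ha => Atom.subst_congr fun v hv => ?_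
  exact key v (FactBase.mem_vars.2 ⟨a, ha, hv⟩)

/-- A trigger whose homomorphism does not extend to the head is applicable. -/
theorem applicable_of_not_extends {t : Trigger} {F : FactBase} (hon : t.IsOn F)
    (h : ¬ ∃ τ : Subst, (∀ v ∈ FactBase.vars t.rule.body, τ v = t.map v) ∧
      IsHom τ ↑t.rule.head ↑F) : Applicable Variant.R t F := by
  rintro ⟨σ, hσ, hid⟩
  refine h ⟨fun v => applyTerm σ (t.ext v), fun v hv => ?_, fun a ha => ?_⟩
  · dsimp only
    rw [Trigger.ext_body hv]
    refine applyTerm_eq_self fun w hw => ?_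
    have hwF : w ∈ FactBase.vars F := IsHom.var_mem hon hv hw
    exact hid w (mem_setVars_coe.2 (FactBase.vars_mono Finset.subset_union_left hwF))
      (mem_setVars_coe.2 hwF)
  · rw [← Atom.subst_subst]
    exact hσ _ (Finset.mem_coe.2 (Finset.mem_union_right _ (Finset.mem_image_of_mem _ ha)))

/-- If the existential variables of a trigger are really fresh, the trigger is not applicable
as soon as its homomorphism extends to the head. -/
theorem not_applicable_of_extends {t : Trigger} {F : FactBase} (hon : t.IsOn F)
    (hfresh : ∀ z ∈ t.rule.exVars, t.freshVar z ∉ FactBase.vars F)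
    (h : ∃ τ : Subst, (∀ v ∈ FactBase.vars t.rule.body, τ v = t.map v) ∧
      IsHom τ ↑t.rule.head ↑F) : ¬ Applicable Variant.R t F := by
  obtain ⟨τ, hτ, hhead⟩ := h
  intro happ
  let σ : Subst := fun w =>
    if h : ∃ z ∈ t.rule.exVars, w = t.freshVar z then τ h.choose else Term.var w
  have hσF : ∀ w ∈ FactBase.vars F, σ w = Term.var w := by
    intro w hw
    refine dif_neg ?_
    rintro ⟨z, hz, rfl⟩
    exact hfresh z hz hw
  have hσz : ∀ z ∈ t.rule.exVars, σ (t.freshVar z) = τ z := by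
    intro z hz
    have hex : ∃ y ∈ t.rule.exVars, t.freshVar z = t.freshVar y := ⟨z, hz, rfl⟩
    have := (Trigger.freshVar_inj hex.choose_spec.2).2.1
    simp only [σ, dif_pos hex]
    rw [← this]
  refine happ ⟨σ, fun a ha => ?_, fun v _ hv => hσF v (mem_setVars_coe.1 hv)⟩
  rcases Finset.mem_union.1 (Finset.mem_coe.1 ha) with ha | ha
  · rw [Atom.subst_eq_self fun v hv => hσF v (FactBase.mem_vars.2 ⟨a, ha, hv⟩)]
    exact ha
  · obtain ⟨b, hb, rfl⟩ := Finset.mem_image.1 ha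
    have : (b.subst t.ext).subst σ = b.subst τ := by
      rw [Atom.subst_subst]
      refine Atom.subst_congr fun v hv => ?_
      rcases Rule.body_or_exVars (FactBase.mem_vars.2 ⟨b, hb, hv⟩) with h | h
      · rw [Trigger.ext_body h, hτ v h]
        exact applyTerm_eq_self fun w hw => hσF w (IsHom.var_mem hon h hw)
      · rw [Trigger.ext_exVars h]
        exact hσz v h
    rw [this]
    exact hhead b hb

theorem Applicable.not_out_subset {t : Trigger} {F : FactBase} (h : Applicable Variant.R t F) :
    ¬ t.out ⊆ F := by
  intro hsub
  refine h ⟨Term.var, fun a ha => ?_, fun v _ _ => rfl⟩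
  rw [Atom.subst_var]
  rwa [Finset.union_eq_left.2 hsub] at ha

/-! ### Chase steps -/

/-- One step of the restricted chase. -/
def Step (𝓢 : RuleSet) (F F' : FactBase) : Prop :=
  ∃ t : Trigger, t.rule ∈ 𝓢 ∧ t.IsOn F ∧ Applicable Variant.R t F ∧ F' = F ∪ t.out

/-- Reachability by finitely many steps of the restricted chase. -/
abbrev Reach (𝓢 : RuleSet) : FactBase → FactBase → Prop := Relation.ReflTransGen (Step 𝓢)

/-- No trigger is applicable. -/
def Terminal (𝓢 : RuleSet) (F : FactBase) : Prop :=
  ∀ t : Trigger, t.rule ∈ 𝓢 → t.IsOn F → ¬ Applicable Variant.R t F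

theorem Reach.subset {𝓢 : RuleSet} {F G : FactBase} (h : Reach 𝓢 F G) : F ⊆ G := by
  induction h with
  | refl => exact subset_rfl
  | tail _ hs ih =>
    obtain ⟨t, -, -, -, rfl⟩ := hs
    exact ih.trans Finset.subset_union_left

theorem exists_derivation_of_reach {𝓢 : RuleSet} {F G : FactBase} (h : Reach 𝓢 F G) :
    ∃ (D : Derivation 𝓢 F) (n : ℕ), D.len = n ∧ D.IsX Variant.R ∧ D.fb n = G := by
  induction h using Relation.ReflTransGen.head_induction_on with
  | refl =>
    refine ⟨⟨0, fun _ => G, fun _ => ⟨⟨{⟨0, []⟩}, {⟨0, []⟩}, by simp, by simp⟩, Term.var⟩, rfl,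
      by simp, by simp, by simp, by simp, by simp⟩, 0, by simp, ?_, rfl⟩
    intro i hi
    simp at hi
  | head hs _ ih =>
    rename_i F F1 _
    obtain ⟨D, n, hlen, hX, hfb⟩ := ih
    obtain ⟨t, hmem, hon, happ, rfl⟩ := hs
    have hlt : ∀ i : ℕ, ((i + 1 : ℕ) : ℕ∞) < ((n + 1 : ℕ) : ℕ∞) ↔ (i : ℕ∞) < D.len := by
      intro i
      rw [hlen, Nat.cast_lt, Nat.cast_lt]
      omega
    refine ⟨⟨((n + 1 : ℕ) : ℕ∞), fun i => Nat.casesOn i F D.fb, fun i => Nat.casesOn i t D.tr,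
      rfl, ?_, ?_, ?_, ?_, ?_⟩, n + 1, rfl, ?_, hfb⟩
    · rintro (_ | i) hi
      exacts [hmem, D.rule_mem i ((hlt i).1 hi)]
    · rintro (_ | i) hi
      exacts [hon, D.trig_on i ((hlt i).1 hi)]
    · rintro (_ | i) hi
      exacts [happ.not_out_subset, D.trig_new i ((hlt i).1 hi)]
    · rintro (_ | i) hi
      exacts [D.fb_zero, D.fb_succ i ((hlt i).1 hi)]
    · rintro (_ | i) hi
      · exact absurd (by exact_mod_cast Nat.succ_pos n) hi
      · exact D.fb_stall i (fun h => hi ((hlt i).2 h))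
    · rintro (_ | i) hi
      exacts [happ, hX i ((hlt i).1 hi)]

theorem ctex_iff {𝓢 : RuleSet} :
    CTex Variant.R 𝓢 ↔ ∀ F : FactBase, ∃ G, Reach 𝓢 F G ∧ Terminal 𝓢 G := by
  constructor
  · intro h F
    obtain ⟨D, hX, hfair, hfin⟩ := h F
    obtain ⟨n, hn⟩ := ENat.ne_top_iff_exists.1 hfin
    have hreach : ∀ i ≤ n, Reach 𝓢 F (D.fb i) := by
      intro i
      induction i with
      | zero => intro _; rw [D.fb_zero]
      | succ i ih =>
        intro hi
        have hlt : (i : ℕ∞) < D.len := by rw [← hn]; exact_mod_cast hi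
        exact (ih (by omega)).tail
          ⟨D.tr i, D.rule_mem i hlt, D.trig_on i hlt, hX i hlt, D.fb_succ i hlt⟩
    refine ⟨D.fb n, hreach n le_rfl, fun t ht hon happ => ?_⟩
    obtain ⟨j, hj, hjn, -⟩ := hfair n hn.le t ht hon happ
    rw [← hn, Nat.cast_le] at hjn
    omega
  · intro h F
    obtain ⟨G, hr, hterm⟩ := h F
    obtain ⟨D, n, hlen, hX, hfb⟩ := exists_derivation_of_reach hr
    refine ⟨D, hX, fun i hi t ht hon happ => ?_, by simp [Derivation.Finite, hlen]⟩
    rw [hlen, Nat.cast_le] at hi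
    have hmono : ∀ j, D.fb i ⊆ D.fb (i + j) := by
      intro j
      induction j with
      | zero => exact subset_rfl
      | succ j ih =>
        by_cases hj : ((i + j : ℕ) : ℕ∞) < D.len
        · rw [← add_assoc, D.fb_succ _ hj]
          exact ih.trans Finset.subset_union_left
        · rw [← add_assoc, D.fb_stall _ hj]
          exact ih
    have honG : t.IsOn G := by
      have := hmono (n - i)
      rw [Nat.add_sub_cancel' hi, hfb] at this
      exact IsHom.mono hon (by exact_mod_cast this)
    have hne : i ≠ n := by
      rintro rfl
      rw [hfb] at happ
      exact hterm t ht honG happ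
    refine ⟨n, by omega, hlen.ge, ?_⟩
    rw [hfb]
    exact hterm t ht honG

/-! ### Freshness of the existential variables

A factbase may already contain variables of the form `z_t`.  A chase can only meet finitely many
of the corresponding triggers, and no such trigger is ever applicable from a stable factbase. -/

/-- Every trigger applicable on a factbase reachable from `F` has fresh existential variables. -/
def Stable (𝓢 : RuleSet) (F : FactBase) : Prop :=
  ∀ G, Reach 𝓢 F G → ∀ t : Trigger, t.rule ∈ 𝓢 → t.IsOn G → Applicable Variant.R t G →
    ∀ z ∈ t.rule.exVars, t.freshVar z ∉ FactBase.vars G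

/-- The variables of `F` that are existential variables of a trigger not applied yet. -/
def clashes (𝓢 : RuleSet) (F : FactBase) : Finset ℕ :=
  (FactBase.vars F).filter fun v =>
    ∃ t : Trigger, t.rule ∈ 𝓢 ∧ (∃ z ∈ t.rule.exVars, v = t.freshVar z) ∧ ¬ t.out ⊆ F

theorem Trigger.mem_vars_out {t : Trigger} {F : FactBase} (hon : t.IsOn F) {w : ℕ}
    (hw : w ∈ FactBase.vars t.out) :
    w ∈ FactBase.vars F ∨ ∃ z ∈ t.rule.exVars, w = t.freshVar z := by
  obtain ⟨a, ha, hwa⟩ := FactBase.mem_vars.1 hw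
  obtain ⟨b, hb, rfl⟩ := Finset.mem_image.1 ha
  obtain ⟨v, hv, hvw⟩ := Atom.mem_vars_subst.1 hwa
  rcases Rule.body_or_exVars (FactBase.mem_vars.2 ⟨b, hb, hv⟩) with h | h
  · rw [Trigger.ext_body h] at hvw
    exact Or.inl (IsHom.var_mem hon h hvw)
  · rw [Trigger.ext_exVars h] at hvw
    exact Or.inr ⟨v, h, (Term.var.inj hvw).symm⟩

theorem FactBase.vars_union (F G : FactBase) :
    FactBase.vars (F ∪ G) = FactBase.vars F ∪ FactBase.vars G :=
  Finset.sup_union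

theorem clashes_union_out {𝓢 : RuleSet} {F : FactBase} {t : Trigger} (hon : t.IsOn F) :
    clashes 𝓢 (F ∪ t.out) ⊆ clashes 𝓢 F ∧
      ∀ z ∈ t.rule.exVars, t.freshVar z ∉ clashes 𝓢 (F ∪ t.out) := by
  have hout : ∀ z, t.freshVar z ∉ clashes 𝓢 (F ∪ t.out) := by
    intro z hz
    obtain ⟨-, s, -, ⟨y, -, hzy⟩, hs⟩ := Finset.mem_filter.1 hz
    obtain ⟨hr, -, hm⟩ := Trigger.freshVar_inj hzy
    rw [← Trigger.out_congr hr hm] at hs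
    exact hs Finset.subset_union_right
  refine ⟨fun v hv => ?_, fun z _ => hout z⟩
  obtain ⟨hvF, s, hs, hsz, hsout⟩ := Finset.mem_filter.1 hv
  refine Finset.mem_filter.2 ⟨?_, s, hs, hsz, fun h => hsout (h.trans Finset.subset_union_left)⟩
  rw [FactBase.vars_union, Finset.mem_union] at hvF
  rcases hvF with h | h
  · exact h
  · rcases Trigger.mem_vars_out hon h with h | ⟨z, -, rfl⟩
    · exact h
    · exact absurd hv (hout z)

theorem mem_clashes {𝓢 : RuleSet} {F : FactBase} {t : Trigger} (ht : t.rule ∈ 𝓢)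
    (happ : Applicable Variant.R t F) {z : ℕ} (hz : z ∈ t.rule.exVars)
    (hmem : t.freshVar z ∈ FactBase.vars F) : t.freshVar z ∈ clashes 𝓢 F :=
  Finset.mem_filter.2 ⟨hmem, t, ht, ⟨z, hz, rfl⟩, happ.not_out_subset⟩

theorem Reach.clashes_subset {𝓢 : RuleSet} {F G : FactBase} (h : Reach 𝓢 F G) :
    clashes 𝓢 G ⊆ clashes 𝓢 F := by
  induction h with
  | refl => exact subset_rfl
  | tail _ hs ih =>
    obtain ⟨t, -, hon, -, rfl⟩ := hs
    exact (clashes_union_out hon).1.trans ih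

theorem stable_of_clashes_eq_empty {𝓢 : RuleSet} {F : FactBase} (h : clashes 𝓢 F = ∅) :
    Stable 𝓢 F := by
  intro G hG t ht _ happ z hz hmem
  have := hG.clashes_subset (mem_clashes ht happ hz hmem)
  simp [h] at this

theorem Stable.reach {𝓢 : RuleSet} {F G : FactBase} (h : Stable 𝓢 F) (hr : Reach 𝓢 F G) :
    Stable 𝓢 G := fun G' hG' => h G' (hr.trans hG')

theorem exists_stable (𝓢 : RuleSet) (F : FactBase) : ∃ G, Reach 𝓢 F G ∧ Stable 𝓢 G := by
  induction hn : (clashes 𝓢 F).card using Nat.strong_induction_on generalizing F with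
  | _ n ih =>
    by_cases hF : Stable 𝓢 F
    · exact ⟨F, .refl, hF⟩
    · simp only [Stable, not_forall, not_not] at hF
      obtain ⟨G, hG, t, ht, hon, happ, z, hz, hmem⟩ := hF
      have hcl := mem_clashes ht happ hz hmem
      have hlt : (clashes 𝓢 (G ∪ t.out)).card < n := by
        rw [← hn]
        refine (Finset.card_lt_card ?_).trans_le (Finset.card_le_card hG.clashes_subset)
        refine (Finset.ssubset_iff_of_subset (clashes_union_out hon).1).2 ⟨_, hcl, ?_⟩
        exact (clashes_union_out hon).2 z hz
      obtain ⟨G', hG', hst⟩ := ih _ hlt _ rfl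
      exact ⟨G', (hG.tail ⟨t, ht, hon, happ, rfl⟩).trans hG', hst⟩

theorem Terminal.satisfiesRule {𝓢 : RuleSet} {F : FactBase} (h : Terminal 𝓢 F) {R : Rule}
    (hR : R ∈ 𝓢) : SatisfiesRule ↑F R := by
  intro π hπ
  by_contra hcon
  exact h ⟨R, π⟩ hR hπ (applicable_of_not_extends hπ hcon)

theorem Stable.terminal {𝓢 : RuleSet} {F : FactBase} (h : Stable 𝓢 F)
    (hsat : ∀ R ∈ 𝓢, SatisfiesRule ↑F R) : Terminal 𝓢 F := fun t ht hon happ =>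
  not_applicable_of_extends hon (h F .refl t ht hon happ) (hsat t.rule ht t.map hon) happ

/-- Chase steps from a stable factbase, described by the extended substitution. -/
theorem Stable.exists_of_step {𝓢 : RuleSet} {F F' : FactBase} (h : Stable 𝓢 F)
    (hs : Step 𝓢 F F') : ∃ R ∈ 𝓢, ∃ σ : Subst, IsHom σ ↑R.body (↑F : Set Atom) ∧
      (∀ z ∈ R.exVars, σ z = Term.var (Trigger.freshVar ⟨R, σ⟩ z) ∧
        Trigger.freshVar ⟨R, σ⟩ z ∉ FactBase.vars F) ∧
      (¬ ∃ τ : Subst, (∀ v ∈ FactBase.vars R.body, τ v = σ v) ∧ IsHom τ ↑R.head ↑F) ∧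
      F' = F ∪ R.head.image (Atom.subst σ) := by
  obtain ⟨t, ht, hon, happ, rfl⟩ := hs
  have hfresh := h F .refl t ht hon happ
  have hbody : ∀ v ∈ FactBase.vars t.rule.body, t.ext v = t.map v := fun _ => Trigger.ext_body
  refine ⟨t.rule, ht, t.ext, hon.congr hbody, fun z hz => ?_, ?_, rfl⟩
  · have : Trigger.freshVar ⟨t.rule, t.ext⟩ z = t.freshVar z :=
      Trigger.freshVar_congr (t := ⟨t.rule, t.ext⟩) (s := t) rfl hbody z
    rw [this]
    exact ⟨Trigger.ext_exVars hz, hfresh z hz⟩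
  · rintro ⟨τ, hτ, hh⟩
    exact not_applicable_of_extends hon hfresh
      ⟨τ, fun v hv => (hτ v hv).trans (hbody v hv), hh⟩ happ

theorem reach_insert_of_datalog {𝓢 : RuleSet} {F : FactBase} {R : Rule} (hR : R ∈ 𝓢) {a : Atom}
    (hhead : R.head = {a}) (hvars : a.vars ⊆ FactBase.vars R.body) {π : Subst}
    (hπ : IsHom π ↑R.body (↑F : Set Atom)) : Reach 𝓢 F (insert (a.subst π) F) := by
  by_cases hmem : a.subst π ∈ F
  · rw [Finset.insert_eq_of_mem hmem]
  · refine .single ⟨⟨R, π⟩, hR, hπ, applicable_of_not_extends hπ ?_, ?_⟩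
    · rintro ⟨τ, hτ, hh⟩
      refine hmem ?_
      have := hh a (by simp [hhead])
      rwa [Atom.subst_congr fun v hv => hτ v (hvars hv)] at this
    · have : Trigger.out ⟨R, π⟩ = {a.subst π} := by
        rw [Trigger.out]
        simp only [hhead, Finset.image_singleton]
        rw [Atom.subst_congr fun v hv => Trigger.ext_body (t := ⟨R, π⟩) (hvars hv)]
      rw [this, Finset.union_comm]
      rfl

theorem reach_union {𝓢 : RuleSet} {F S : FactBase}
    (h : ∀ a ∈ S, ∀ G, F ⊆ G → Reach 𝓢 G (insert a G)) : Reach 𝓢 F (S ∪ F) := by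
  induction S using Finset.induction_on with
  | empty => rw [Finset.empty_union]
  | insert a S _ ih =>
    rw [Finset.insert_union]
    exact (ih fun b hb => h b (Finset.mem_insert_of_mem hb)).trans
      (h a (Finset.mem_insert_self _ _) _ Finset.subset_union_right)

/-! ### The two-way atomic decomposition -/

section TwoAd

variable {𝓡 : RuleSet} {Q : FactBase}

theorem mem_twoAd {r : Rule} : r ∈ twoAd 𝓡 ↔ ∃ R ∈ 𝓡,
    r = ⟨R.body, {xAtom 𝓡 R}, R.body_nonempty, Finset.singleton_nonempty _⟩ ∨
    (∃ a ∈ R.head,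
      r = ⟨{xAtom 𝓡 R}, {a}, Finset.singleton_nonempty _, Finset.singleton_nonempty _⟩) ∨
    r = ⟨R.head, {xAtom 𝓡 R}, R.head_nonempty, Finset.singleton_nonempty _⟩ := by
  simp only [twoAd, oneAd, Finset.mem_union, Finset.mem_biUnion, oneAdRule, Finset.mem_insert,
    Finset.mem_image, Finset.mem_attach, true_and, Subtype.exists]
  constructor
  · rintro (⟨R, hR, h | ⟨a, ha, h⟩⟩ | ⟨R, hR, h⟩)
    exacts [⟨R, hR, .inl h⟩, ⟨R, hR, .inr (.inl ⟨a, ha, h.symm⟩)⟩, ⟨R, hR, .inr (.inr h.symm)⟩]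
  · rintro ⟨R, hR, h | ⟨a, ha, h⟩ | h⟩
    exacts [.inl ⟨R, hR, .inl h⟩, .inl ⟨R, hR, .inr ⟨a, ha, h.symm⟩⟩, .inr ⟨R, hR, h.symm⟩]

theorem mem_vars_xAtom {R : Rule} {v : ℕ} :
    v ∈ (xAtom 𝓡 R).vars ↔ v ∈ FactBase.vars R.head := by
  simp only [Atom.mem_vars, xAtom, List.mem_append, List.mem_map, Finset.mem_sort,
    Term.var.injEq, exists_eq_right, Rule.frontier, Rule.exVars, Finset.mem_inter,
    Finset.mem_sdiff]
  tauto

theorem xAtom_subst_inj {R R' : Rule} {τ τ' : Subst}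
    (h : (xAtom 𝓡 R).subst τ = (xAtom 𝓡 R').subst τ') :
    R = R' ∧ ∀ v ∈ FactBase.vars R.head, τ v = τ' v := by
  have hp : freshPred 𝓡 R = freshPred 𝓡 R' := congrArg Atom.pred h
  obtain rfl : R = R' := Encodable.encode_injective (Nat.add_left_cancel hp)
  refine ⟨rfl, fun v hv => ?_⟩
  have hargs := congrArg Atom.args h
  simp only [Atom.subst] at hargs
  exact List.map_inj_left.1 hargs _ (Atom.mem_vars.1 (mem_vars_xAtom.2 hv))

theorem pred_mem_predsF_head {R : Rule} (hR : R ∈ 𝓡) {a : Atom} (ha : a ∈ R.head) :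
    a.pred ∈ RuleSet.predsF 𝓡 :=
  Finset.mem_sup.2 ⟨R, hR, Finset.mem_union_right _ (Finset.mem_image_of_mem _ ha)⟩

theorem pred_mem_predsF_body {R : Rule} (hR : R ∈ 𝓡) {a : Atom} (ha : a ∈ R.body) :
    a.pred ∈ RuleSet.predsF 𝓡 :=
  Finset.mem_sup.2 ⟨R, hR, Finset.mem_union_left _ (Finset.mem_image_of_mem _ ha)⟩

theorem freshPred_notMem (R : Rule) : freshPred 𝓡 R ∉ RuleSet.predsF 𝓡 := by
  intro h
  have : freshPred 𝓡 R ≤ (RuleSet.predsF 𝓡).sup id := Finset.le_sup (f := id) h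
  simp only [freshPred] at this
  omega

theorem xAtom_subst_ne {R : Rule} {τ : Subst} {a : Atom} (ha : a.pred ∈ RuleSet.predsF 𝓡) :
    a ≠ (xAtom 𝓡 R).subst τ := by
  rintro rfl
  exact freshPred_notMem R ha

/-- `F` is closed under the rules `X_R(x,z) → P(t)` stemming from `R`. -/
def Unfolded (𝓡 : RuleSet) (R : Rule) (F : FactBase) : Prop :=
  ∀ τ : Subst, (xAtom 𝓡 R).subst τ ∈ F → IsHom τ ↑R.head ↑F

theorem Unfolded.union {R : Rule} (h : Unfolded 𝓡 R Q) {S : FactBase}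
    (hS : ∀ a ∈ S, a.pred ∈ RuleSet.predsF 𝓡) : Unfolded 𝓡 R (S ∪ Q) := by
  intro τ hτ
  rcases Finset.mem_union.1 hτ with h' | h'
  · exact absurd rfl (xAtom_subst_ne (hS _ h'))
  · exact (h τ h').mono (by exact_mod_cast Finset.subset_union_right)

theorem Unfolded.insert_ne {R R' : Rule} (h : Unfolded 𝓡 R Q) (hne : R' ≠ R) (τ : Subst) :
    Unfolded 𝓡 R (insert ((xAtom 𝓡 R').subst τ) Q) := by
  intro ρ hρ
  rcases Finset.mem_insert.1 hρ with h' | h'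
  · exact absurd (xAtom_subst_inj h').1.symm hne
  · exact (h ρ h').mono (by exact_mod_cast Finset.subset_insert _ _)

theorem reach_insert_head {R : Rule} (hR : R ∈ 𝓡) {a : Atom} (ha : a ∈ R.head) {τ : Subst}
    (hτ : (xAtom 𝓡 R).subst τ ∈ Q) : Reach (twoAd 𝓡) Q (insert (a.subst τ) Q) := by
  refine reach_insert_of_datalog (mem_twoAd.2 ⟨R, hR, .inr (.inl ⟨a, ha, rfl⟩)⟩) rfl ?_ ?_
  · intro v hv
    have := FactBase.mem_vars.2 ⟨a, ha, hv⟩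
    simpa [FactBase.vars, mem_vars_xAtom] using this
  · intro b hb
    obtain rfl := Finset.mem_singleton.1 (Finset.mem_coe.1 hb)
    exact hτ

theorem reach_insert_xAtom {R : Rule} (hR : R ∈ 𝓡) {τ : Subst}
    (hτ : IsHom τ ↑R.head (↑Q : Set Atom)) :
    Reach (twoAd 𝓡) Q (insert ((xAtom 𝓡 R).subst τ) Q) :=
  reach_insert_of_datalog (mem_twoAd.2 ⟨R, hR, .inr (.inr rfl)⟩) rfl
    (fun _ hv => mem_vars_xAtom.1 hv) hτ

/-- Introducing the atom `X_R` for a homomorphism that does not extend to the head. -/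
theorem exists_reach_insert_xAtom (hQ : Stable (twoAd 𝓡) Q) {R : Rule} (hR : R ∈ 𝓡)
    (hunf : Unfolded 𝓡 R Q) {π : Subst} (hπ : IsHom π ↑R.body (↑Q : Set Atom))
    (hext : ¬ ∃ τ : Subst, (∀ v ∈ FactBase.vars R.body, τ v = π v) ∧ IsHom τ ↑R.head ↑Q) :
    ∃ (τ : Subst) (n : ℕ → ℕ), (∀ v ∈ FactBase.vars R.body, τ v = π v) ∧
      (∀ z ∈ R.exVars, τ z = Term.var (n z) ∧ n z ∉ FactBase.vars Q) ∧ Function.Injective n ∧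
      Reach (twoAd 𝓡) Q (insert ((xAtom 𝓡 R).subst τ) Q) := by
  set r : Rule := ⟨R.body, {xAtom 𝓡 R}, R.body_nonempty, Finset.singleton_nonempty _⟩ with hr
  have hrmem : r ∈ twoAd 𝓡 := mem_twoAd.2 ⟨R, hR, .inl rfl⟩
  have hex : r.exVars = R.exVars := by
    ext z
    rw [Rule.mem_exVars, Rule.mem_exVars]
    simp [hr, FactBase.vars, mem_vars_xAtom]
  have happ : Applicable Variant.R ⟨r, π⟩ Q := by
    refine applicable_of_not_extends hπ ?_
    rintro ⟨τ, hτ, hh⟩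
    exact hext ⟨τ, hτ, hunf τ (hh _ (by simp [hr]))⟩
  have hfresh := hQ Q .refl ⟨r, π⟩ hrmem hπ happ
  refine ⟨Trigger.ext ⟨r, π⟩, Trigger.freshVar ⟨r, π⟩, fun v hv => Trigger.ext_body hv,
    fun z hz => ?_, fun _ _ h => (Trigger.freshVar_inj h).2.1,
    .single ⟨⟨r, π⟩, hrmem, hπ, happ, ?_⟩⟩
  · rw [← hex] at hz
    exact ⟨Trigger.ext_exVars (t := ⟨r, π⟩) hz, hfresh z hz⟩
  · rw [Finset.union_comm]
    simp only [Trigger.out, hr, Finset.image_singleton]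
    rfl

/-- Simulation of an application of an undecomposed rule. -/
theorem exists_reach_head (hQ : Stable (twoAd 𝓡) Q) {R : Rule} (hR : R ∈ 𝓡)
    (hunf : Unfolded 𝓡 R Q) {π : Subst} (hπ : IsHom π ↑R.body (↑Q : Set Atom))
    (hext : ¬ ∃ τ : Subst, (∀ v ∈ FactBase.vars R.body, τ v = π v) ∧ IsHom τ ↑R.head ↑Q) :
    ∃ (τ : Subst) (n : ℕ → ℕ) (Q' : FactBase), (∀ v ∈ FactBase.vars R.body, τ v = π v) ∧
      (∀ z ∈ R.exVars, τ z = Term.var (n z) ∧ n z ∉ FactBase.vars Q) ∧ Function.Injective n ∧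
      Reach (twoAd 𝓡) Q Q' ∧ (∀ R', Unfolded 𝓡 R' Q → Unfolded 𝓡 R' Q') ∧
      ∀ a, a ∈ Q' ↔ a = (xAtom 𝓡 R).subst τ ∨ a ∈ R.head.image (Atom.subst τ) ∨ a ∈ Q := by
  obtain ⟨τ, n, hτ, hz, hinj, hreach⟩ := exists_reach_insert_xAtom hQ hR hunf hπ hext
  have hpreds : ∀ a ∈ R.head.image (Atom.subst τ), a.pred ∈ RuleSet.predsF 𝓡 := by
    intro a ha
    obtain ⟨b, hb, rfl⟩ := Finset.mem_image.1 ha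
    exact pred_mem_predsF_head hR (a := b) hb
  refine ⟨τ, n, R.head.image (Atom.subst τ) ∪ insert ((xAtom 𝓡 R).subst τ) Q, hτ, hz, hinj,
    hreach.trans (reach_union fun a ha G hG => ?_), fun R' hR' => ?_, fun a => ?_⟩
  · obtain ⟨b, hb, rfl⟩ := Finset.mem_image.1 ha
    exact reach_insert_head hR hb (hG (Finset.mem_insert_self _ _))
  · by_cases hne : R = R'
    · subst hne
      intro ρ hρ a ha
      rcases Finset.mem_union.1 hρ with h | h
      · exact absurd rfl (xAtom_subst_ne (hpreds _ h))
      · rcases Finset.mem_insert.1 h with h | h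
        · rw [Atom.subst_congr fun v hv =>
            (xAtom_subst_inj h).2 v (FactBase.mem_vars.2 ⟨a, ha, hv⟩)]
          exact Finset.mem_union_left _ (Finset.mem_image_of_mem _ ha)
        · exact Finset.mem_union_right _ (Finset.mem_insert_of_mem (hR' ρ h a ha))
    · exact (hR'.insert_ne hne τ).union hpreds
  · simp only [Finset.mem_union, Finset.mem_insert]
    tauto

/-- The terms of a factbase. -/
def FactBase.terms (F : FactBase) : Finset Term := F.biUnion fun a => a.args.toFinset

theorem mem_terms_of_subst_mem {a : Atom} {τ : Subst} {v : ℕ} (hv : v ∈ a.vars)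
    (h : a.subst τ ∈ Q) : τ v ∈ FactBase.terms Q :=
  Finset.mem_biUnion.2 ⟨_, h, List.mem_toFinset.2 (List.mem_map.2 ⟨_, Atom.mem_vars.1 hv, rfl⟩)⟩

theorem finite_setOf_subst (a : Atom) (T : Finset Term) :
    {b | ∃ τ : Subst, (∀ v ∈ a.vars, τ v ∈ T) ∧ b = a.subst τ}.Finite := by
  have hfin : {ρ : a.vars → Term | ∀ i, ρ i ∈ (T : Set Term)}.Finite :=
    Set.Finite.pi' fun _ => T.finite_toSet
  refine (hfin.image fun ρ =>
    a.subst fun v => if h : v ∈ a.vars then ρ ⟨v, h⟩ else .var v).subset ?_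
  rintro _ ⟨τ, hτ, rfl⟩
  refine ⟨fun i => τ i, fun i => hτ i i.2, Atom.subst_congr fun v hv => ?_⟩
  simp [hv]

theorem exists_reach_unfolded (𝓡 : RuleSet) (Q : FactBase) :
    ∃ Q', Reach (twoAd 𝓡) Q Q' ∧ ∀ R ∈ 𝓡, Unfolded 𝓡 R Q' := by
  have hfin : {b | ∃ R ∈ 𝓡, ∃ a ∈ R.head, ∃ τ : Subst,
      (xAtom 𝓡 R).subst τ ∈ Q ∧ b = a.subst τ}.Finite := by
    refine ((𝓡.biUnion Rule.head).finite_toSet.biUnion fun a _ =>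
      finite_setOf_subst a (FactBase.terms Q)).subset ?_
    rintro _ ⟨R, hR, a, ha, τ, hτ, rfl⟩
    refine Set.mem_biUnion (Finset.mem_coe.2 (Finset.mem_biUnion.2 ⟨R, hR, ha⟩))
      ⟨τ, fun v hv => ?_, rfl⟩
    exact mem_terms_of_subst_mem (mem_vars_xAtom.2 (FactBase.mem_vars.2 ⟨a, ha, hv⟩)) hτ
  refine ⟨hfin.toFinset ∪ Q, reach_union fun b hb G hG => ?_, fun R hR τ hτ a ha => ?_⟩
  · obtain ⟨R, hR, a, ha, τ, hτ, rfl⟩ := (Set.Finite.mem_toFinset hfin).1 hb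
    exact reach_insert_head hR ha (hG hτ)
  · rcases Finset.mem_union.1 hτ with h | h
    · obtain ⟨R', hR', a', ha', τ', -, h'⟩ := (Set.Finite.mem_toFinset hfin).1 h
      exact absurd h'.symm (xAtom_subst_ne (pred_mem_predsF_head hR' (a := a') ha'))
    · exact Finset.mem_union_left _ ((Set.Finite.mem_toFinset hfin).2 ⟨R, hR, a, ha, τ, h, rfl⟩)

/-- A stable unfolded factbase satisfying the original rules can be completed by atoms over the
fresh predicates. -/
theorem exists_reach_terminal (hQ : Stable (twoAd 𝓡) Q) (hunf : ∀ R ∈ 𝓡, Unfolded 𝓡 R Q)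
    (hsat : ∀ R ∈ 𝓡, SatisfiesRule ↑Q R) :
    ∃ Q', Reach (twoAd 𝓡) Q Q' ∧ Terminal (twoAd 𝓡) Q' := by
  have hfin : {b | ∃ R ∈ 𝓡, ∃ τ : Subst, IsHom τ ↑R.head (↑Q : Set Atom) ∧
      b = (xAtom 𝓡 R).subst τ}.Finite := by
    refine (𝓡.finite_toSet.biUnion fun R _ =>
      finite_setOf_subst (xAtom 𝓡 R) (FactBase.terms Q)).subset ?_
    rintro _ ⟨R, hR, τ, hτ, rfl⟩
    refine Set.mem_biUnion (Finset.mem_coe.2 hR) ⟨τ, fun v hv => ?_, rfl⟩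
    obtain ⟨a, ha, hva⟩ := FactBase.mem_vars.1 (mem_vars_xAtom.1 hv)
    exact mem_terms_of_subst_mem hva (hτ a ha)
  have hreach : Reach (twoAd 𝓡) Q (hfin.toFinset ∪ Q) := by
    refine reach_union fun b hb G hG => ?_
    obtain ⟨R, hR, τ, hτ, rfl⟩ := (Set.Finite.mem_toFinset hfin).1 hb
    exact reach_insert_xAtom hR (hτ.mono (by exact_mod_cast hG))
  have hback : ∀ (B : Finset Atom) (π : Subst), (∀ a ∈ B, a.pred ∈ RuleSet.predsF 𝓡) →
      IsHom π ↑B (↑(hfin.toFinset ∪ Q) : Set Atom) → IsHom π ↑B (↑Q : Set Atom) := by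
    intro B π hB hπ a ha
    rcases Finset.mem_union.1 (Finset.mem_coe.1 (hπ a ha)) with h | h
    · obtain ⟨R, -, τ, -, h'⟩ := (Set.Finite.mem_toFinset hfin).1 h
      exact absurd h' (xAtom_subst_ne (hB a ha))
    · exact h
  refine ⟨_, hreach, (hQ.reach hreach).terminal fun r hr π hπ => ?_⟩
  have hx : ∀ R ∈ 𝓡, ∀ τ, IsHom τ ↑R.head (↑Q : Set Atom) →
      IsHom τ ↑({xAtom 𝓡 R} : Finset Atom) (↑(hfin.toFinset ∪ Q) : Set Atom) := by
    intro R hR τ hτ a ha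
    obtain rfl := Finset.mem_singleton.1 (Finset.mem_coe.1 ha)
    exact Finset.mem_coe.2
      (Finset.mem_union_left _ ((Set.Finite.mem_toFinset hfin).2 ⟨R, hR, τ, hτ, rfl⟩))
  obtain ⟨R, hR, rfl | ⟨a, ha, rfl⟩ | rfl⟩ := mem_twoAd.1 hr
  · obtain ⟨τ, hτ, hh⟩ := hsat R hR π (hback _ _ (fun a ha => pred_mem_predsF_body hR ha) hπ)
    exact ⟨τ, hτ, hx R hR τ hh⟩
  · refine ⟨π, fun _ _ => rfl, fun b hb => ?_⟩
    obtain rfl := Finset.mem_singleton.1 (Finset.mem_coe.1 hb)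
    refine Finset.mem_coe.2 (Finset.mem_union_right _ ?_)
    have hX : (xAtom 𝓡 R).subst π ∈ hfin.toFinset ∪ Q := hπ _ (by simp)
    rcases Finset.mem_union.1 hX with h | h
    · obtain ⟨R', -, τ, hτ, h'⟩ := (Set.Finite.mem_toFinset hfin).1 h
      obtain ⟨rfl, hv⟩ := xAtom_subst_inj h'
      rw [Atom.subst_congr fun v hvb => hv v (FactBase.mem_vars.2 ⟨b, ha, hvb⟩)]
      exact hτ b ha
    · exact hunf R hR π h b ha
  · exact ⟨π, fun _ _ => rfl,
      hx R hR π (hback _ _ (fun a ha => pred_mem_predsF_head hR ha) hπ)⟩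

/-- `Q` contains a copy of `P` under the variable renaming `f`, and its remaining atoms use no
predicate of `𝓡`. -/
structure Simulates (𝓡 : RuleSet) (f : ℕ → ℕ) (P Q : FactBase) : Prop where
  injOn : Set.InjOn f ↑(FactBase.vars P)
  subst_mem : ∀ b ∈ P, b.subst (fun v => Term.var (f v)) ∈ Q
  exists_of_mem : ∀ a ∈ Q, a.pred ∈ RuleSet.predsF 𝓡 →
    ∃ b ∈ P, b.subst (fun v => Term.var (f v)) = a

theorem Simulates.map_mem_vars {f : ℕ → ℕ} {P : FactBase} (h : Simulates 𝓡 f P Q) {v : ℕ}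
    (hv : v ∈ FactBase.vars P) : f v ∈ FactBase.vars Q := by
  obtain ⟨a, ha, hva⟩ := FactBase.mem_vars.1 hv
  exact FactBase.mem_vars.2 ⟨_, h.subst_mem a ha, Atom.mem_vars_subst.2 ⟨v, hva, rfl⟩⟩

theorem Simulates.exists_pullback {f : ℕ → ℕ} {P : FactBase} (h : Simulates 𝓡 f P Q) :
    ∃ g : Subst, (∀ v ∈ FactBase.vars P, g (f v) = Term.var v) ∧
      (∀ (B : Finset Atom) (π : Subst), (∀ a ∈ B, a.pred ∈ RuleSet.predsF 𝓡) →
        IsHom π ↑B (↑Q : Set Atom) →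
        IsHom (fun v => applyTerm g (π v)) ↑B (↑P : Set Atom) ∧
        ∀ v ∈ FactBase.vars B, applyTerm (fun v => Term.var (f v)) (applyTerm g (π v)) = π v) := by
  have hg : ∀ v ∈ FactBase.vars P,
      Term.var (Function.invFunOn f ↑(FactBase.vars P) (f v)) = Term.var v :=
    fun v hv => congrArg _ (h.injOn.leftInvOn_invFunOn (Finset.mem_coe.2 hv))
  refine ⟨fun w => Term.var (Function.invFunOn f ↑(FactBase.vars P) w), hg,
    fun B π hB hπ => ⟨fun a ha => ?_, fun v hv => ?_⟩⟩
  · obtain ⟨b, hb, hba⟩ := h.exists_of_mem _ (hπ a ha) (hB a ha)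
    rw [← Atom.subst_subst, ← hba, Atom.subst_subst]
    exact (congrArg (· ∈ P) (Atom.subst_eq_self
      fun v hv => hg v (FactBase.mem_vars.2 ⟨b, hb, hv⟩))).mpr hb
  · cases hw : π v with
    | const c => rfl
    | var w =>
      obtain ⟨a, ha, hva⟩ := FactBase.mem_vars.1 hv
      obtain ⟨b, hb, hba⟩ := h.exists_of_mem _ (hπ a ha) (hB a ha)
      have : w ∈ (a.subst π).vars := Atom.mem_vars_subst.2 ⟨v, hva, hw⟩
      rw [← hba] at this
      obtain ⟨u, hu, huw⟩ := Atom.mem_vars_subst.1 this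
      obtain rfl := Term.var.inj huw
      exact congrArg (fun t => applyTerm (fun v => Term.var (f v)) t)
        (hg u (FactBase.mem_vars.2 ⟨b, hb, hu⟩))

theorem Simulates.satisfiesRule {f : ℕ → ℕ} {P : FactBase} (h : Simulates 𝓡 f P Q) {R : Rule}
    (hR : R ∈ 𝓡) (hsat : SatisfiesRule ↑P R) : SatisfiesRule ↑Q R := by
  intro π hπ
  obtain ⟨g, -, hpull⟩ := h.exists_pullback
  obtain ⟨hhom, hid⟩ := hpull _ π (fun a ha => pred_mem_predsF_body hR ha) hπ
  obtain ⟨τ, hτ, hh⟩ := hsat _ hhom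
  refine ⟨fun v => applyTerm (fun v => Term.var (f v)) (τ v), fun v hv => ?_, fun a ha => ?_⟩
  · dsimp only
    rw [hτ v hv]
    exact hid v hv
  · rw [← Atom.subst_subst]
    exact h.subst_mem _ (hh a ha)

theorem Simulates.step {f : ℕ → ℕ} {P P' : FactBase} (h : Simulates 𝓡 f P Q) (hP : Stable 𝓡 P)
    (hQ : Stable (twoAd 𝓡) Q) (hunf : ∀ R ∈ 𝓡, Unfolded 𝓡 R Q) (hs : Step 𝓡 P P') :
    ∃ f' Q', Reach (twoAd 𝓡) Q Q' ∧ Simulates 𝓡 f' P' Q' ∧ ∀ R ∈ 𝓡, Unfolded 𝓡 R Q' := by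
  obtain ⟨t, hR, hon, happ, rfl⟩ := hs
  have hfresh := hP P .refl t hR hon happ
  have hhom : IsHom (fun v => applyTerm (fun v => Term.var (f v)) (t.map v)) ↑t.rule.body
      (↑Q : Set Atom) := by
    intro a ha
    rw [← Atom.subst_subst]
    exact h.subst_mem _ (hon a ha)
  obtain ⟨τ, n, Q', hτ, hn, hninj, hreach, hunf', hQ'⟩ :=
      exists_reach_head hQ hR (hunf _ hR) hhom <| by
    rintro ⟨τ, hτ, hh⟩
    obtain ⟨g, hg, hpull⟩ := h.exists_pullback
    refine not_applicable_of_extends hon hfresh ⟨_, fun v hv => ?_,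
      (hpull _ τ (fun a ha => pred_mem_predsF_head hR ha) hh).1⟩ happ
    rw [hτ v hv]
    cases hw : t.map v with
    | const c => rfl
    | var w => exact hg w (IsHom.var_mem hon hv hw)
  let f' : ℕ → ℕ := fun w =>
    if h : ∃ z ∈ t.rule.exVars, w = t.freshVar z then n h.choose else f w
  have hf'P : ∀ w ∈ FactBase.vars P, f' w = f w := by
    intro w hw
    refine dif_neg ?_
    rintro ⟨z, hz, rfl⟩
    exact hfresh z hz hw
  have hf'z : ∀ z ∈ t.rule.exVars, f' (t.freshVar z) = n z := by
    intro z hz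
    have hex : ∃ y ∈ t.rule.exVars, t.freshVar z = t.freshVar y := ⟨z, hz, rfl⟩
    have := (Trigger.freshVar_inj hex.choose_spec.2).2.1
    simp only [f', dif_pos hex]
    rw [← this]
  have hf'old : ∀ b ∈ P, b.subst (fun v => Term.var (f' v)) = b.subst (fun v => Term.var (f v)) :=
    fun b hb => Atom.subst_congr fun v hv =>
      congrArg _ (hf'P v (FactBase.mem_vars.2 ⟨b, hb, hv⟩))
  have hf'out : ∀ a ∈ t.rule.head,
      (a.subst t.ext).subst (fun v => Term.var (f' v)) = a.subst τ := by
    intro a ha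
    rw [Atom.subst_subst]
    refine Atom.subst_congr fun v hv => ?_
    rcases Rule.body_or_exVars (FactBase.mem_vars.2 ⟨a, ha, hv⟩) with hb | hz
    · rw [Trigger.ext_body hb, hτ v hb]
      exact applyTerm_congr fun w hw => congrArg _ (hf'P w (IsHom.var_mem hon hb hw))
    · rw [Trigger.ext_exVars hz, (hn v hz).1]
      exact congrArg _ (hf'z v hz)
  refine ⟨f', Q', hreach, ⟨?_, ?_, ?_⟩, fun R hR => hunf' R (hunf R hR)⟩
  · have hvars : ∀ w ∈ FactBase.vars (P ∪ t.out),
        w ∈ FactBase.vars P ∨ ∃ z ∈ t.rule.exVars, w = t.freshVar z := by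
      intro w hw
      rw [FactBase.vars_union, Finset.mem_union] at hw
      exact hw.elim .inl (Trigger.mem_vars_out hon)
    have hmix : ∀ w ∈ FactBase.vars P, ∀ z ∈ t.rule.exVars, f' w ≠ f' (t.freshVar z) := by
      intro w hw z hz heq
      rw [hf'P w hw, hf'z z hz] at heq
      exact (hn z hz).2 (heq ▸ h.map_mem_vars hw)
    intro w hw w' hw' heq
    rcases hvars w hw with h1 | ⟨z, hz, rfl⟩ <;> rcases hvars w' hw' with h2 | ⟨z', hz', rfl⟩
    · rw [hf'P w h1, hf'P w' h2] at heq
      exact h.injOn h1 h2 heq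
    · exact absurd heq (hmix w h1 z' hz')
    · exact absurd heq.symm (hmix w' h2 z hz)
    · rw [hf'z z hz, hf'z z' hz'] at heq
      rw [hninj heq]
  · intro b hb
    rcases Finset.mem_union.1 hb with hb | hb
    · rw [hf'old b hb]
      exact (hQ' _).2 (.inr (.inr (h.subst_mem b hb)))
    · obtain ⟨a, ha, rfl⟩ := Finset.mem_image.1 hb
      rw [hf'out a ha]
      exact (hQ' _).2 (.inr (.inl (Finset.mem_image_of_mem _ ha)))
  · intro a ha hpred
    rcases (hQ' a).1 ha with rfl | ha | ha
    · exact absurd rfl (xAtom_subst_ne hpred)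
    · obtain ⟨b, hb, rfl⟩ := Finset.mem_image.1 ha
      exact ⟨_, Finset.mem_union_right _ (Finset.mem_image_of_mem _ hb), hf'out b hb⟩
    · obtain ⟨b, hb, rfl⟩ := h.exists_of_mem a ha hpred
      exact ⟨b, Finset.mem_union_left _ hb, hf'old b hb⟩

theorem Simulates.reach {f : ℕ → ℕ} {P P' : FactBase} (h : Simulates 𝓡 f P Q) (hP : Stable 𝓡 P)
    (hQ : Stable (twoAd 𝓡) Q) (hunf : ∀ R ∈ 𝓡, Unfolded 𝓡 R Q) (hr : Reach 𝓡 P P') :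
    ∃ f' Q', Reach (twoAd 𝓡) Q Q' ∧ Simulates 𝓡 f' P' Q' ∧ ∀ R ∈ 𝓡, Unfolded 𝓡 R Q' := by
  induction hr with
  | refl => exact ⟨f, Q, .refl, h, hunf⟩
  | tail hr hs ih =>
    obtain ⟨f₁, Q₁, hQ₁, hsim, hunf₁⟩ := ih
    obtain ⟨f₂, Q₂, hQ₂, hsim₂, hunf₂⟩ :=
      hsim.step (hP.reach hr) (hQ.reach hQ₁) hunf₁ hs
    exact ⟨f₂, Q₂, hQ₁.trans hQ₂, hsim₂, hunf₂⟩

/-- Every factbase is simulated by itself, after a renaming of the simulated side that makes it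
stable. -/
theorem exists_simulates (𝓡 : RuleSet) (Q : FactBase) :
    ∃ f P, Stable 𝓡 P ∧ Simulates 𝓡 f P Q := by
  obtain ⟨Z, hZ⟩ := Infinite.exists_notMem_finset (𝓡.biUnion Rule.exVars)
  have hid : ∀ a : Atom, (a.subst fun v => Term.var (Nat.pair v Z)).subst
      (fun v => Term.var (Nat.unpair v).1) = a := by
    intro a
    rw [Atom.subst_subst]
    exact Atom.subst_eq_self fun v _ => by simp [applyTerm]
  have hvars : ∀ w ∈ FactBase.vars (Q.image (Atom.subst fun v => Term.var (Nat.pair v Z))),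
      ∃ v, w = Nat.pair v Z := by
    intro w hw
    obtain ⟨a, ha, hwa⟩ := FactBase.mem_vars.1 hw
    obtain ⟨b, -, rfl⟩ := Finset.mem_image.1 ha
    obtain ⟨v, -, hv⟩ := Atom.mem_vars_subst.1 hwa
    exact ⟨v, (Term.var.inj hv).symm⟩
  refine ⟨fun v => (Nat.unpair v).1, Q.image (Atom.subst fun v => Term.var (Nat.pair v Z)),
    stable_of_clashes_eq_empty (Finset.eq_empty_of_forall_notMem ?_), ⟨?_, ?_, ?_⟩⟩
  · intro w hw
    obtain ⟨hw, t, ht, ⟨z, hz, rfl⟩, -⟩ := Finset.mem_filter.1 hw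
    obtain ⟨v, hv⟩ := hvars _ hw
    obtain rfl : z = Z := (Nat.pair_eq_pair.1 hv).2
    exact hZ (Finset.mem_biUnion.2 ⟨_, ht, hz⟩)
  · intro w hw w' hw' heq
    obtain ⟨v, rfl⟩ := hvars w hw
    obtain ⟨v', rfl⟩ := hvars w' hw'
    simp only [Nat.unpair_pair] at heq
    rw [heq]
  · intro b hb
    obtain ⟨a, ha, rfl⟩ := Finset.mem_image.1 hb
    rwa [hid]
  · intro a ha _
    exact ⟨_, Finset.mem_image_of_mem _ ha, hid a⟩

theorem CTex.twoAd (h : CTex Variant.R 𝓡) : CTex Variant.R (twoAd 𝓡) := by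
  refine ctex_iff.2 fun F => ?_
  obtain ⟨G, hG, hst⟩ := exists_stable (ExRules.twoAd 𝓡) F
  obtain ⟨Q, hQ, hunf⟩ := exists_reach_unfolded 𝓡 G
  obtain ⟨f, P, hP, hsim⟩ := exists_simulates 𝓡 Q
  obtain ⟨P', hP', hterm⟩ := ctex_iff.1 h P
  obtain ⟨f', Q', hQ', hsim', hunf'⟩ := hsim.reach hP (hst.reach hQ) hunf hP'
  obtain ⟨E, hE, hEterm⟩ := exists_reach_terminal ((hst.reach hQ).reach hQ') hunf'
    fun R hR => hsim'.satisfiesRule hR (hterm.satisfiesRule hR)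
  exact ⟨E, ((hG.trans hQ).trans hQ').trans hE, hEterm⟩

end TwoAd

/-! ### The witness -/

def ruleA : Rule := ⟨{aA vx}, {aR3 vx vx vx, aR3 vx vy vz},
  Finset.singleton_nonempty _, Finset.insert_nonempty _ _⟩

def ruleR : Rule := ⟨{aR3 vx vy vz}, {aR3 vx vx vt},
  Finset.singleton_nonempty _, Finset.singleton_nonempty _⟩

def ruleS : Rule := ⟨{aR3 vx vx vy}, {aS3 vx vy vz},
  Finset.singleton_nonempty _, Finset.singleton_nonempty _⟩

def ruleLoop : Rule := ⟨{aR3 vx vx vy, aS3 vx vy vz}, {aS3 vx vx vx},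
  Finset.insert_nonempty _ _, Finset.singleton_nonempty _⟩

def ruleProp : Rule := ⟨{aA vx, aS3 vx vx vy}, {aA vy},
  Finset.insert_nonempty _ _, Finset.singleton_nonempty _⟩

theorem mem_R13set {R : Rule} : R ∈ R13set ↔
    R = ruleA ∨ R = ruleR ∨ R = ruleS ∨ R = ruleLoop ∨ R = ruleProp := by
  simp [R13set, ruleA, ruleR, ruleS, ruleLoop, ruleProp]

theorem aA_subst (σ : Subst) (t : Term) : (aA t).subst σ = aA (applyTerm σ t) := rfl

theorem aR3_subst (σ : Subst) (t u v : Term) :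
    (aR3 t u v).subst σ = aR3 (applyTerm σ t) (applyTerm σ u) (applyTerm σ v) := rfl

theorem aS3_subst (σ : Subst) (t u v : Term) :
    (aS3 t u v).subst σ = aS3 (applyTerm σ t) (applyTerm σ u) (applyTerm σ v) := rfl

theorem applyTerm_vx (σ : Subst) : applyTerm σ vx = σ 0 := rfl

theorem applyTerm_vy (σ : Subst) : applyTerm σ vy = σ 1 := rfl

theorem applyTerm_vz (σ : Subst) : applyTerm σ vz = σ 2 := rfl

theorem applyTerm_vt (σ : Subst) : applyTerm σ vt = σ 3 := rfl

theorem aA_inj {t t' : Term} : aA t = aA t' ↔ t = t' := by simp [aA]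

theorem aR3_inj {t u v t' u' v' : Term} :
    aR3 t u v = aR3 t' u' v' ↔ t = t' ∧ u = u' ∧ v = v' := by simp [aR3]

theorem aS3_inj {t u v t' u' v' : Term} :
    aS3 t u v = aS3 t' u' v' ↔ t = t' ∧ u = u' ∧ v = v' := by simp [aS3]

theorem aA_ne_aR3 {s t u v : Term} : aA s ≠ aR3 t u v := by simp [aA, aR3]

theorem aA_ne_aS3 {s t u v : Term} : aA s ≠ aS3 t u v := by simp [aA, aS3]

theorem aR3_ne_aS3 {t u v t' u' v' : Term} : aR3 t u v ≠ aS3 t' u' v' := by simp [aR3, aS3]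

theorem mem_vars_aA {v : ℕ} {t : Term} : v ∈ (aA t).vars ↔ Term.var v = t := by
  simp [Atom.mem_vars, aA]

theorem mem_vars_aR3 {v : ℕ} {s t u : Term} :
    v ∈ (aR3 s t u).vars ↔ Term.var v = s ∨ Term.var v = t ∨ Term.var v = u := by
  simp [Atom.mem_vars, aR3]

theorem mem_vars_aS3 {v : ℕ} {s t u : Term} :
    v ∈ (aS3 s t u).vars ↔ Term.var v = s ∨ Term.var v = t ∨ Term.var v = u := by
  simp [Atom.mem_vars, aS3]

theorem mem_vars_body_ruleA {v : ℕ} : v ∈ FactBase.vars ruleA.body ↔ v = 0 := by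
  simp [ruleA, FactBase.mem_vars, mem_vars_aA, vx]

theorem mem_vars_body_ruleR {v : ℕ} :
    v ∈ FactBase.vars ruleR.body ↔ v = 0 ∨ v = 1 ∨ v = 2 := by
  simp [ruleR, FactBase.mem_vars, mem_vars_aR3, vx, vy, vz]

theorem mem_vars_body_ruleS {v : ℕ} : v ∈ FactBase.vars ruleS.body ↔ v = 0 ∨ v = 1 := by
  simp [ruleS, FactBase.mem_vars, mem_vars_aR3, vx, vy]

theorem mem_vars_body_ruleLoop {v : ℕ} :
    v ∈ FactBase.vars ruleLoop.body ↔ v = 0 ∨ v = 1 ∨ v = 2 := by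
  simp [ruleLoop, FactBase.mem_vars, mem_vars_aR3, mem_vars_aS3, vx, vy, vz]
  tauto

theorem mem_vars_body_ruleProp {v : ℕ} :
    v ∈ FactBase.vars ruleProp.body ↔ v = 0 ∨ v = 1 := by
  simp [ruleProp, FactBase.mem_vars, mem_vars_aA, mem_vars_aS3, vx, vy]

theorem mem_exVars_ruleA {v : ℕ} : v ∈ ruleA.exVars ↔ v = 1 ∨ v = 2 := by
  rw [Rule.mem_exVars, mem_vars_body_ruleA]
  simp [ruleA, FactBase.mem_vars, mem_vars_aR3, vx, vy, vz]
  omega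

theorem mem_exVars_ruleR {v : ℕ} : v ∈ ruleR.exVars ↔ v = 3 := by
  rw [Rule.mem_exVars, mem_vars_body_ruleR]
  simp [ruleR, FactBase.mem_vars, mem_vars_aR3, vx, vt]
  omega

theorem mem_exVars_ruleS {v : ℕ} : v ∈ ruleS.exVars ↔ v = 2 := by
  rw [Rule.mem_exVars, mem_vars_body_ruleS]
  simp [ruleS, FactBase.mem_vars, mem_vars_aS3, vx, vy, vz]
  omega

theorem isHom_body_ruleA {σ : Subst} {S : Set Atom} :
    IsHom σ ↑ruleA.body S ↔ aA (σ 0) ∈ S := by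
  simp [IsHom, ruleA, aA_subst, applyTerm_vx]

theorem isHom_body_ruleR {σ : Subst} {S : Set Atom} :
    IsHom σ ↑ruleR.body S ↔ aR3 (σ 0) (σ 1) (σ 2) ∈ S := by
  simp [IsHom, ruleR, aR3_subst, applyTerm_vx, applyTerm_vy, applyTerm_vz]

theorem isHom_body_ruleS {σ : Subst} {S : Set Atom} :
    IsHom σ ↑ruleS.body S ↔ aR3 (σ 0) (σ 0) (σ 1) ∈ S := by
  simp [IsHom, ruleS, aR3_subst, applyTerm_vx, applyTerm_vy]

theorem isHom_body_ruleLoop {σ : Subst} {S : Set Atom} :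
    IsHom σ ↑ruleLoop.body S ↔ aR3 (σ 0) (σ 0) (σ 1) ∈ S ∧ aS3 (σ 0) (σ 1) (σ 2) ∈ S := by
  simp [IsHom, ruleLoop, aR3_subst, aS3_subst, applyTerm_vx, applyTerm_vy, applyTerm_vz]

theorem isHom_body_ruleProp {σ : Subst} {S : Set Atom} :
    IsHom σ ↑ruleProp.body S ↔ aA (σ 0) ∈ S ∧ aS3 (σ 0) (σ 0) (σ 1) ∈ S := by
  simp [IsHom, ruleProp, aA_subst, aS3_subst, applyTerm_vx, applyTerm_vy]

theorem isHom_head_ruleA {σ : Subst} {S : Set Atom} : IsHom σ ↑ruleA.head S ↔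
    aR3 (σ 0) (σ 0) (σ 0) ∈ S ∧ aR3 (σ 0) (σ 1) (σ 2) ∈ S := by
  simp [IsHom, ruleA, aR3_subst, applyTerm_vx, applyTerm_vy, applyTerm_vz]

theorem isHom_head_ruleR {σ : Subst} {S : Set Atom} :
    IsHom σ ↑ruleR.head S ↔ aR3 (σ 0) (σ 0) (σ 3) ∈ S := by
  simp [IsHom, ruleR, aR3_subst, applyTerm_vx, applyTerm_vt]

theorem isHom_head_ruleS {σ : Subst} {S : Set Atom} :
    IsHom σ ↑ruleS.head S ↔ aS3 (σ 0) (σ 1) (σ 2) ∈ S := by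
  simp [IsHom, ruleS, aS3_subst, applyTerm_vx, applyTerm_vy, applyTerm_vz]

theorem isHom_head_ruleLoop {σ : Subst} {S : Set Atom} :
    IsHom σ ↑ruleLoop.head S ↔ aS3 (σ 0) (σ 0) (σ 0) ∈ S := by
  simp [IsHom, ruleLoop, aS3_subst, applyTerm_vx]

theorem isHom_head_ruleProp {σ : Subst} {S : Set Atom} :
    IsHom σ ↑ruleProp.head S ↔ aA (σ 1) ∈ S := by
  simp [IsHom, ruleProp, aA_subst, applyTerm_vy]

theorem image_head_ruleA (σ : Subst) : ruleA.head.image (Atom.subst σ) =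
    {aR3 (σ 0) (σ 0) (σ 0), aR3 (σ 0) (σ 1) (σ 2)} := by
  simp [ruleA, Finset.image_insert, aR3_subst, applyTerm_vx, applyTerm_vy, applyTerm_vz]

theorem image_head_ruleS (σ : Subst) : ruleS.head.image (Atom.subst σ) =
    {aS3 (σ 0) (σ 1) (σ 2)} := rfl

theorem image_head_ruleLoop (σ : Subst) : ruleLoop.head.image (Atom.subst σ) =
    {aS3 (σ 0) (σ 0) (σ 0)} := rfl

theorem image_head_ruleProp (σ : Subst) : ruleProp.head.image (Atom.subst σ) =
    {aA (σ 1)} := rfl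

/-- The substitution mapping the variables `0`, `1`, `2` to the given terms. -/
def subst3 (u v w : Term) : Subst
  | 0 => u
  | 1 => v
  | _ => w

theorem var_ne_of_aA_mem {F : FactBase} {u : Term} {n : ℕ} (h : aA u ∈ F)
    (hn : n ∉ FactBase.vars F) : Term.var n ≠ u :=
  fun hu => hn (FactBase.mem_vars.2 ⟨_, h, mem_vars_aA.2 hu⟩)

theorem var_ne_of_aR3_mem {F : FactBase} {u v w : Term} {n : ℕ} (h : aR3 u v w ∈ F)
    (hn : n ∉ FactBase.vars F) : Term.var n ≠ u ∧ Term.var n ≠ v ∧ Term.var n ≠ w := by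
  refine ⟨?_, ?_, ?_⟩ <;> intro hu <;>
    exact hn (FactBase.mem_vars.2 ⟨_, h, mem_vars_aR3.2 (by tauto)⟩)

theorem var_ne_of_aS3_mem {F : FactBase} {u v w : Term} {n : ℕ} (h : aS3 u v w ∈ F)
    (hn : n ∉ FactBase.vars F) : Term.var n ≠ u ∧ Term.var n ≠ v ∧ Term.var n ≠ w := by
  refine ⟨?_, ?_, ?_⟩ <;> intro hu <;>
    exact hn (FactBase.mem_vars.2 ⟨_, h, mem_vars_aS3.2 (by tauto)⟩)

/-! ### The chase with the original rules never terminates -/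

/-- The existential variable introduced by applying `ruleS` to `R(u,u,u)`. -/
def nextTerm (u : Term) : Term := Term.var (Trigger.freshVar ⟨ruleS, fun _ => u⟩ 2)

theorem nextTerm_injective : Function.Injective nextTerm := fun _ _ h =>
  (Trigger.freshVar_inj (Term.var.inj h)).2.2 0 (mem_vars_body_ruleS.2 (.inl rfl))

theorem iterate_nextTerm_injective (c : ℕ) :
    Function.Injective fun n => nextTerm^[n] (Term.const c) := by
  intro m n h
  induction m generalizing n with
  | zero =>
    cases n with
    | zero => rfl
    | succ n => simp [Function.iterate_succ_apply', nextTerm] at h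
  | succ m ih =>
    cases n with
    | zero => simp [Function.iterate_succ_apply', nextTerm] at h
    | succ n =>
      simp only [Function.iterate_succ_apply'] at h
      rw [ih (nextTerm_injective h)]

theorem ruleS_freshVar_eq {σ : Subst} (h : σ 1 = σ 0) :
    Term.var (Trigger.freshVar ⟨ruleS, σ⟩ 2) = nextTerm (σ 0) := by
  refine congrArg _ (Trigger.freshVar_congr (t := ⟨ruleS, σ⟩) (s := ⟨ruleS, fun _ => σ 0⟩) rfl
    (fun v hv => ?_) 2)
  rcases mem_vars_body_ruleS.1 hv with rfl | rfl
  exacts [rfl, h]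

/-- The invariant of the chase from a single fact over `A`. -/
structure ChaseInv (F : FactBase) : Prop where
  loop_of_mem : ∀ {u v w}, aR3 u v w ∈ F → aR3 u u u ∈ F
  eq_of_mem : ∀ {u w}, aR3 u u w ∈ F → w = u
  next_of_mem : ∀ {u v w}, aS3 u v w ∈ F → aS3 u u (nextTerm u) ∈ F

theorem ChaseInv.step {F F' : FactBase} (h : ChaseInv F) (hF : Stable R13set F)
    (hs : Step R13set F F') : ChaseInv F' := by
  obtain ⟨R, hR, σ, hσ, hfresh, hext, rfl⟩ := hF.exists_of_step hs
  rcases mem_R13set.1 hR with rfl | rfl | rfl | rfl | rfl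
  · rw [image_head_ruleA]
    have hA := isHom_body_ruleA.1 hσ
    obtain ⟨h1, h1'⟩ := hfresh 1 (mem_exVars_ruleA.2 (.inl rfl))
    have hne : σ 1 ≠ σ 0 := h1 ▸ var_ne_of_aA_mem hA h1'
    refine ⟨fun {u v w} hm => ?_, fun {u w} hm => ?_, fun {u v w} hm => ?_⟩ <;>
      simp only [Finset.mem_union, Finset.mem_insert, Finset.mem_singleton, aR3_inj,
        aR3_ne_aS3.symm, or_false] at hm ⊢
    · rcases hm with hm | ⟨rfl, -⟩ | ⟨rfl, -⟩
      exacts [.inl (h.loop_of_mem hm), by simp, by simp]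
    · rcases hm with hm | ⟨rfl, -, rfl⟩ | ⟨rfl, h0, -⟩
      exacts [h.eq_of_mem hm, rfl, absurd h0.symm hne]
    · exact h.next_of_mem hm
  · refine absurd ⟨fun v => if v = 3 then σ 0 else σ v, fun v hv => ?_, ?_⟩ hext
    · rcases mem_vars_body_ruleR.1 hv with rfl | rfl | rfl <;> rfl
    · exact isHom_head_ruleR.2 (h.loop_of_mem (isHom_body_ruleR.1 hσ))
  · rw [image_head_ruleS]
    have h1 := h.eq_of_mem (isHom_body_ruleS.1 hσ)
    have h2 := (hfresh 2 (mem_exVars_ruleS.2 rfl)).1.trans (ruleS_freshVar_eq h1)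
    refine ⟨fun {u v w} hm => ?_, fun {u w} hm => ?_, fun {u v w} hm => ?_⟩ <;>
      simp only [Finset.mem_union, Finset.mem_singleton, aS3_inj, aR3_ne_aS3, or_false] at hm ⊢
    · exact h.loop_of_mem hm
    · exact h.eq_of_mem hm
    · rcases hm with hm | ⟨rfl, -, -⟩
      exacts [.inl (h.next_of_mem hm), .inr ⟨rfl, h1.symm, h2.symm⟩]
  · rw [image_head_ruleLoop]
    have hS := (isHom_body_ruleLoop.1 hσ).2
    refine ⟨fun {u v w} hm => ?_, fun {u w} hm => ?_, fun {u v w} hm => ?_⟩ <;>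
      simp only [Finset.mem_union, Finset.mem_singleton, aS3_inj, aR3_ne_aS3, or_false] at hm ⊢
    · exact h.loop_of_mem hm
    · exact h.eq_of_mem hm
    · rcases hm with hm | ⟨rfl, -, -⟩
      exacts [.inl (h.next_of_mem hm), .inl (h.next_of_mem hS)]
  · rw [image_head_ruleProp]
    refine ⟨fun {u v w} hm => ?_, fun {u w} hm => ?_, fun {u v w} hm => ?_⟩ <;>
      simp only [Finset.mem_union, Finset.mem_singleton, aA_ne_aR3.symm, aA_ne_aS3.symm,
        or_false] at hm ⊢
    · exact h.loop_of_mem hm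
    · exact h.eq_of_mem hm
    · exact h.next_of_mem hm

theorem not_ctex_R13set : ¬ CTex Variant.R R13set := by
  intro hct
  obtain ⟨G, hG, hterm⟩ := ctex_iff.1 hct {aA (.const 0)}
  have hst : Stable R13set {aA (.const 0)} := by
    refine stable_of_clashes_eq_empty (Finset.eq_empty_of_forall_notMem fun v hv => ?_)
    simpa [FactBase.mem_vars, mem_vars_aA] using (Finset.mem_filter.1 hv).1
  have hinv : ChaseInv G := by
    refine hG.head_induction_on
      (motive := fun F _ => Stable R13set F → ChaseInv F → ChaseInv G) (fun _ h => h)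
      (fun hs _ ih hF h => ih (hF.reach (.single hs)) (h.step hF hs)) hst ?_
    constructor <;> simp [aA_ne_aR3.symm, aA_ne_aS3.symm]
  have hsat : ∀ R ∈ R13set, SatisfiesRule ↑G R := fun R hR => hterm.satisfiesRule hR
  have hnext : ∀ u, aA u ∈ G → aA (nextTerm u) ∈ G := by
    intro u hu
    obtain ⟨τ, hτ, hh⟩ := hsat ruleA (mem_R13set.2 (by simp)) (subst3 u u u)
      (isHom_body_ruleA.2 hu)
    have hR := (isHom_head_ruleA.1 hh).1
    rw [hτ 0 (mem_vars_body_ruleA.2 rfl)] at hR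
    obtain ⟨τ, hτ, hh⟩ := hsat ruleS (mem_R13set.2 (by simp)) (subst3 u u u)
      (isHom_body_ruleS.2 hR)
    have hS := isHom_head_ruleS.1 hh
    rw [hτ 0 (mem_vars_body_ruleS.2 (.inl rfl))] at hS
    obtain ⟨τ, hτ, hh⟩ := hsat ruleProp (mem_R13set.2 (by simp)) (subst3 u (nextTerm u) u)
      (isHom_body_ruleProp.2 ⟨hu, hinv.next_of_mem hS⟩)
    have hA := isHom_head_ruleProp.1 hh
    rwa [hτ 1 (mem_vars_body_ruleProp.2 (.inr rfl))] at hA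
  have hall : ∀ n, aA (nextTerm^[n] (.const 0)) ∈ G := by
    intro n
    induction n with
    | zero => exact hG.subset (Finset.mem_singleton_self _)
    | succ n ih =>
      rw [Function.iterate_succ_apply']
      exact hnext _ ih
  exact Set.infinite_range_of_injective
    (fun m n h => iterate_nextTerm_injective 0 (aA_inj.1 h))
    (G.finite_toSet.subset (Set.range_subset_iff.2 hall))

/-! ### The chase with the decomposed rules sometimes terminates -/

theorem pred_mem_predsF_R13set {a : Atom} (h : a.pred ≤ 2) :
    a.pred ∈ RuleSet.predsF R13set := by
  have h0 : ∀ b ∈ ruleProp.body, b.pred ∈ RuleSet.predsF R13set :=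
    fun b hb => pred_mem_predsF_body (R := ruleProp) (mem_R13set.2 (by simp)) hb
  have h1 : ∀ b ∈ ruleR.body, b.pred ∈ RuleSet.predsF R13set :=
    fun b hb => pred_mem_predsF_body (R := ruleR) (mem_R13set.2 (by simp)) hb
  interval_cases hp : a.pred
  · exact h0 (aA vx) (by simp [ruleProp])
  · exact h1 (aR3 vx vy vz) (by simp [ruleR])
  · exact h0 (aS3 vx vx vy) (by simp [ruleProp])

theorem aA_mem_body_ruleA : aA vx ∈ ruleA.body := Finset.mem_singleton_self _

theorem ruleR_ne_ruleA : ruleR ≠ ruleA := by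
  intro h
  have := aA_mem_body_ruleA
  rw [← h] at this
  simp [ruleR, aA_ne_aR3] at this

theorem ruleS_ne_ruleA : ruleS ≠ ruleA := by
  intro h
  have := aA_mem_body_ruleA
  rw [← h] at this
  simp [ruleS, aA_ne_aR3] at this

theorem ruleLoop_ne_ruleA : ruleLoop ≠ ruleA := by
  intro h
  have := aA_mem_body_ruleA
  rw [← h] at this
  simp [ruleLoop, aA_ne_aR3, aA_ne_aS3] at this

/-- A stable factbase closed under the unfolding of every rule, except possibly `ruleA`. -/
structure WeaklyReady (Q : FactBase) : Prop where
  stable : Stable (twoAd R13set) Q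
  unfolded_of_ne : ∀ R ∈ R13set, R ≠ ruleA → Unfolded R13set R Q

/-- A stable factbase closed under the unfolding of every rule. -/
structure Ready (Q : FactBase) : Prop where
  stable : Stable (twoAd R13set) Q
  unfolded : ∀ R ∈ R13set, Unfolded R13set R Q

theorem Ready.weaklyReady {Q : FactBase} (h : Ready Q) : WeaklyReady Q :=
  ⟨h.stable, fun R hR _ => h.unfolded R hR⟩

/-- `Q'` is obtained from `Q` without applying `ruleA`. -/
structure Evolves (Q Q' : FactBase) : Prop where
  reach : Reach (twoAd R13set) Q Q'
  unfolded_of_ne : ∀ R, R ≠ ruleA → Unfolded R13set R Q → Unfolded R13set R Q'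
  xAtom_mem : ∀ ρ, (xAtom R13set ruleA).subst ρ ∈ Q' → (xAtom R13set ruleA).subst ρ ∈ Q

theorem Evolves.refl (Q : FactBase) : Evolves Q Q := ⟨.refl, fun _ _ h => h, fun _ h => h⟩

theorem Evolves.trans {Q Q' Q'' : FactBase} (h : Evolves Q Q') (h' : Evolves Q' Q'') :
    Evolves Q Q'' :=
  ⟨h.reach.trans h'.reach, fun R hR hu => h'.unfolded_of_ne R hR (h.unfolded_of_ne R hR hu),
    fun ρ hρ => h.xAtom_mem ρ (h'.xAtom_mem ρ hρ)⟩

theorem Evolves.weaklyReady {Q Q' : FactBase} (h : Evolves Q Q') (hQ : WeaklyReady Q) :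
    WeaklyReady Q' :=
  ⟨hQ.stable.reach h.reach, fun R hR hne => h.unfolded_of_ne R hne (hQ.unfolded_of_ne R hR hne)⟩

theorem Evolves.ready {Q Q' : FactBase} (h : Evolves Q Q') (hQ : Ready Q) : Ready Q' := by
  refine ⟨hQ.stable.reach h.reach, fun R hR => ?_⟩
  by_cases hne : R = ruleA
  · subst hne
    exact fun ρ hρ => (hQ.unfolded _ hR ρ (h.xAtom_mem ρ hρ)).mono
      (Finset.coe_subset.2 h.reach.subset)
  · exact h.unfolded_of_ne R hne (hQ.unfolded R hR)

/-- Up to auxiliary atoms, `Q'` is obtained from `Q` by adding the atom `b`. -/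
structure Adds (Q : FactBase) (b : Atom) (Q' : FactBase) : Prop extends Evolves Q Q' where
  mem_iff : ∀ a : Atom, a.pred ≤ 2 → (a ∈ Q' ↔ a = b ∨ a ∈ Q)

theorem Adds.aA_mem {Q Q' : FactBase} {b : Atom} (h : Adds Q b Q') {u : Term} :
    aA u ∈ Q' ↔ aA u = b ∨ aA u ∈ Q := h.mem_iff _ (by simp [aA])

theorem Adds.aR3_mem {Q Q' : FactBase} {b : Atom} (h : Adds Q b Q') {u v w : Term} :
    aR3 u v w ∈ Q' ↔ aR3 u v w = b ∨ aR3 u v w ∈ Q := h.mem_iff _ (by simp [aR3])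

theorem Adds.aS3_mem {Q Q' : FactBase} {b : Atom} (h : Adds Q b Q') {u v w : Term} :
    aS3 u v w ∈ Q' ↔ aS3 u v w = b ∨ aS3 u v w ∈ Q := h.mem_iff _ (by simp [aS3])

theorem Adds.of_mem {Q : FactBase} {b : Atom} (h : b ∈ Q) : Adds Q b Q where
  toEvolves := .refl Q
  mem_iff _ _ := ⟨.inr, fun ha => ha.elim (fun h' => h' ▸ h) id⟩

theorem WeaklyReady.exists_adds {Q : FactBase} (hQ : WeaklyReady Q) {R : Rule} (hR : R ∈ R13set)
    (hne : R ≠ ruleA) {π : Subst} (hπ : IsHom π ↑R.body (↑Q : Set Atom))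
    (hext : ¬ ∃ τ : Subst, (∀ v ∈ FactBase.vars R.body, τ v = π v) ∧ IsHom τ ↑R.head ↑Q)
    {a : Atom} (ha : R.head = {a}) :
    ∃ (τ : Subst) (Q' : FactBase), (∀ v ∈ FactBase.vars R.body, τ v = π v) ∧
      (∀ z ∈ R.exVars, ∃ n, τ z = Term.var n ∧ n ∉ FactBase.vars Q) ∧
      Adds Q (a.subst τ) Q' := by
  obtain ⟨τ, n, Q', hτ, hz, -, hreach, hunf, hmem⟩ :=
    exists_reach_head hQ.stable hR (hQ.unfolded_of_ne R hR hne) hπ hext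
  have hhead : ∀ b, b ∈ R.head.image (Atom.subst τ) ↔ b = a.subst τ := by simp [ha]
  have hpred : (a.subst τ).pred ∈ RuleSet.predsF R13set :=
    pred_mem_predsF_head hR (a := a) (by simp [ha])
  refine ⟨τ, Q', hτ, fun z h => ⟨n z, hz z h⟩,
    ⟨⟨hreach, fun R' _ => hunf R', fun ρ hρ => ?_⟩, fun b hb => ?_⟩⟩
  · rcases (hmem _).1 hρ with h | h | h
    · exact absurd (xAtom_subst_inj h).1.symm hne
    · exact absurd ((hhead _).1 h).symm (xAtom_subst_ne hpred)
    · exact h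
  · rw [hmem, hhead]
    have := xAtom_subst_ne (R := R) (τ := τ) (pred_mem_predsF_R13set hb)
    tauto

theorem WeaklyReady.exists_adds_ruleR {Q : FactBase} (hQ : WeaklyReady Q) {u v w : Term}
    (h : aR3 u v w ∈ Q) (hno : ∀ t, aR3 u u t ∉ Q) :
    ∃ n Q', n ∉ FactBase.vars Q ∧ Adds Q (aR3 u u (.var n)) Q' := by
  obtain ⟨τ, Q', hτ, hz, hadds⟩ := hQ.exists_adds (mem_R13set.2 (by simp)) ruleR_ne_ruleA
    (π := subst3 u v w) (isHom_body_ruleR.2 h) (by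
      rintro ⟨τ, hτ, hh⟩
      have := isHom_head_ruleR.1 hh
      rw [hτ 0 (mem_vars_body_ruleR.2 (.inl rfl))] at this
      exact hno _ this) (a := aR3 vx vx vt) rfl
  obtain ⟨n, hn, hnQ⟩ := hz 3 (mem_exVars_ruleR.2 rfl)
  rw [aR3_subst, applyTerm_vx, applyTerm_vt, hn, hτ 0 (mem_vars_body_ruleR.2 (.inl rfl))] at hadds
  exact ⟨n, Q', hnQ, hadds⟩

theorem WeaklyReady.exists_adds_ruleS {Q : FactBase} (hQ : WeaklyReady Q) {u v : Term}
    (h : aR3 u u v ∈ Q) (hno : ∀ t, aS3 u v t ∉ Q) :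
    ∃ n Q', n ∉ FactBase.vars Q ∧ Adds Q (aS3 u v (.var n)) Q' := by
  obtain ⟨τ, Q', hτ, hz, hadds⟩ := hQ.exists_adds (mem_R13set.2 (by simp)) ruleS_ne_ruleA
    (π := subst3 u v v) (isHom_body_ruleS.2 h) (by
      rintro ⟨τ, hτ, hh⟩
      have := isHom_head_ruleS.1 hh
      rw [hτ 0 (mem_vars_body_ruleS.2 (.inl rfl)), hτ 1 (mem_vars_body_ruleS.2 (.inr rfl))] at this
      exact hno _ this) (a := aS3 vx vy vz) rfl
  obtain ⟨n, hn, hnQ⟩ := hz 2 (mem_exVars_ruleS.2 rfl)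
  rw [aS3_subst, applyTerm_vx, applyTerm_vy, applyTerm_vz, hn,
    hτ 0 (mem_vars_body_ruleS.2 (.inl rfl)), hτ 1 (mem_vars_body_ruleS.2 (.inr rfl))] at hadds
  exact ⟨n, Q', hnQ, hadds⟩

theorem WeaklyReady.exists_adds_ruleLoop {Q : FactBase} (hQ : WeaklyReady Q) {u v w : Term}
    (h : aR3 u u v ∈ Q) (h' : aS3 u v w ∈ Q) : ∃ Q', Adds Q (aS3 u u u) Q' := by
  by_cases hmem : aS3 u u u ∈ Q
  · exact ⟨Q, .of_mem hmem⟩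
  have h0 : 0 ∈ FactBase.vars ruleLoop.body := mem_vars_body_ruleLoop.2 (.inl rfl)
  obtain ⟨τ, Q', hτ, -, hadds⟩ := hQ.exists_adds (mem_R13set.2 (by simp)) ruleLoop_ne_ruleA
    (π := subst3 u v w) (isHom_body_ruleLoop.2 ⟨h, h'⟩) (by
      rintro ⟨τ, hτ, hh⟩
      have := isHom_head_ruleLoop.1 hh
      rw [hτ 0 h0] at this
      exact hmem this) (a := aS3 vx vx vx) rfl
  rw [aS3_subst, applyTerm_vx, hτ 0 h0] at hadds
  exact ⟨Q', hadds⟩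

theorem ruleProp_ne_ruleA : ruleProp ≠ ruleA := by
  intro h
  have : aS3 vx vx vy ∈ ruleA.body := by rw [← h]; simp [ruleProp]
  simp [ruleA, aA_ne_aS3.symm] at this

theorem WeaklyReady.exists_adds_ruleProp {Q : FactBase} (hQ : WeaklyReady Q) {u v : Term}
    (h : aA u ∈ Q) (h' : aS3 u u v ∈ Q) : ∃ Q', Adds Q (aA v) Q' := by
  by_cases hmem : aA v ∈ Q
  · exact ⟨Q, .of_mem hmem⟩
  have h1 : 1 ∈ FactBase.vars ruleProp.body := mem_vars_body_ruleProp.2 (.inr rfl)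
  obtain ⟨τ, Q', hτ, -, hadds⟩ := hQ.exists_adds (mem_R13set.2 (by simp)) ruleProp_ne_ruleA
    (π := subst3 u v v) (isHom_body_ruleProp.2 ⟨h, h'⟩) (by
      rintro ⟨τ, hτ, hh⟩
      have := isHom_head_ruleProp.1 hh
      rw [hτ 1 h1] at this
      exact hmem this) (a := aA vy) rfl
  rw [aA_subst, applyTerm_vy, hτ 1 h1] at hadds
  exact ⟨Q', hadds⟩

/-- Repairing the bad atoms one by one. -/
theorem exists_reach_good {𝓢 : RuleSet} {P Good : FactBase → Prop}
    (bad : FactBase → Atom → Prop)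
    (step : ∀ Q, P Q → ¬ Good Q → ∃ Q', Reach 𝓢 Q Q' ∧ P Q' ∧
      (∀ b ∈ Q', bad Q' b → b ∈ Q ∧ bad Q b) ∧ ∃ a ∈ Q, bad Q a ∧ ¬ bad Q' a)
    {Q : FactBase} (hQ : P Q) : ∃ Q', Reach 𝓢 Q Q' ∧ P Q' ∧ Good Q' := by
  induction hn : (Q.filter (bad Q)).card using Nat.strong_induction_on generalizing Q with
  | _ n ih =>
    by_cases hgood : Good Q
    · exact ⟨Q, .refl, hQ, hgood⟩
    obtain ⟨Q', hreach, hP, hbad, a, ha, hab, hab'⟩ := step Q hQ hgood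
    have hlt : (Q'.filter (bad Q')).card < n := by
      rw [← hn]
      refine Finset.card_lt_card ((Finset.ssubset_iff_of_subset fun b hb => ?_).2
        ⟨a, Finset.mem_filter.2 ⟨ha, hab⟩, fun h => hab' (Finset.mem_filter.1 h).2⟩)
      exact Finset.mem_filter.2 (hbad b (Finset.mem_filter.1 hb).1 (Finset.mem_filter.1 hb).2)
    obtain ⟨Q'', hreach', h⟩ := ih _ hlt hP rfl
    exact ⟨Q'', hreach.trans hreach', h⟩

def SatR (Q : FactBase) : Prop := ∀ u v w, aR3 u v w ∈ Q → ∃ t, aR3 u u t ∈ Q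

def SatS (Q : FactBase) : Prop := ∀ u v, aR3 u u v ∈ Q → ∃ t, aS3 u v t ∈ Q

def SatLoop (Q : FactBase) : Prop :=
  ∀ u v w, aR3 u u v ∈ Q → aS3 u v w ∈ Q → aS3 u u u ∈ Q

def SatProp (Q : FactBase) : Prop := ∀ u v, aA u ∈ Q → aS3 u u v ∈ Q → aA v ∈ Q

theorem exists_satR {Q : FactBase} (hQ : Ready Q) :
    ∃ Q', Reach (twoAd R13set) Q Q' ∧ Ready Q' ∧ SatR Q' := by
  refine exists_reach_good (fun Q a => ∃ u v w, a = aR3 u v w ∧ ∀ t, aR3 u u t ∉ Q)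
    (fun Q hQ hno => ?_) hQ
  simp only [SatR, not_forall, not_exists] at hno
  obtain ⟨u, v, w, hm, hno⟩ := hno
  obtain ⟨n, Q', -, hadds⟩ := hQ.weaklyReady.exists_adds_ruleR hm hno
  refine ⟨Q', hadds.reach, hadds.ready hQ, ?_, _, hm, ⟨u, v, w, rfl, hno⟩, ?_⟩
  · rintro _ hb ⟨x, y, z, rfl, hx⟩
    refine ⟨(hadds.aR3_mem.1 hb).resolve_left fun h => ?_, x, y, z, rfl,
      fun t ht => hx t (hadds.aR3_mem.2 (.inr ht))⟩
    obtain ⟨rfl, rfl, rfl⟩ := aR3_inj.1 h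
    exact hx _ hb
  · rintro ⟨x, y, z, h, hx⟩
    obtain ⟨rfl, -, -⟩ := aR3_inj.1 h
    exact hx _ (hadds.aR3_mem.2 (.inl rfl))

theorem exists_satS {Q : FactBase} (hQ : Ready Q) (hR : SatR Q) :
    ∃ Q', Reach (twoAd R13set) Q Q' ∧ (Ready Q' ∧ SatR Q') ∧ SatS Q' := by
  refine exists_reach_good (P := fun Q => Ready Q ∧ SatR Q)
    (fun Q a => ∃ u v, a = aR3 u u v ∧ ∀ t, aS3 u v t ∉ Q)
    (fun Q ⟨hQ, hR⟩ hno => ?_) ⟨hQ, hR⟩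
  simp only [SatS, not_forall, not_exists] at hno
  obtain ⟨u, v, hm, hno⟩ := hno
  obtain ⟨n, Q', -, hadds⟩ := hQ.weaklyReady.exists_adds_ruleS hm hno
  have hR3 : ∀ {x y z}, aR3 x y z ∈ Q' ↔ aR3 x y z ∈ Q := by
    simp [hadds.aR3_mem, aR3_ne_aS3]
  refine ⟨Q', hadds.reach, ⟨hadds.ready hQ, ?_⟩, ?_, _, hm, ⟨u, v, rfl, hno⟩, ?_⟩
  · simpa only [SatR, hR3] using hR
  · rintro _ hb ⟨x, y, rfl, hx⟩
    exact ⟨hR3.1 hb, x, y, rfl, fun t ht => hx t (hadds.aS3_mem.2 (.inr ht))⟩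
  · rintro ⟨x, y, h, hx⟩
    obtain ⟨rfl, -, rfl⟩ := aR3_inj.1 h
    exact hx _ (hadds.aS3_mem.2 (.inl rfl))

theorem exists_satLoop {Q : FactBase} (hQ : Ready Q) (hR : SatR Q) (hS : SatS Q) :
    ∃ Q', Reach (twoAd R13set) Q Q' ∧ (Ready Q' ∧ SatR Q' ∧ SatS Q') ∧ SatLoop Q' := by
  refine exists_reach_good (P := fun Q => Ready Q ∧ SatR Q ∧ SatS Q)
    (fun Q a => ∃ u v w, a = aS3 u v w ∧ aR3 u u v ∈ Q ∧ aS3 u u u ∉ Q)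
    (fun Q ⟨hQ, hR, hS⟩ hno => ?_) ⟨hQ, hR, hS⟩
  simp only [SatLoop, not_forall] at hno
  obtain ⟨u, v, w, hm, hm', hno⟩ := hno
  obtain ⟨Q', hadds⟩ := hQ.weaklyReady.exists_adds_ruleLoop hm hm'
  have hR3 : ∀ {x y z}, aR3 x y z ∈ Q' ↔ aR3 x y z ∈ Q := by
    simp [hadds.aR3_mem, aR3_ne_aS3]
  refine ⟨Q', hadds.reach, ⟨hadds.ready hQ, ?_, fun x y h => ?_⟩, ?_, _, hm',
    ⟨u, v, w, rfl, hm, hno⟩, ?_⟩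
  · simpa only [SatR, hR3] using hR
  · obtain ⟨t, ht⟩ := hS x y (hR3.1 h)
    exact ⟨t, hadds.aS3_mem.2 (.inr ht)⟩
  · rintro _ hb ⟨x, y, z, rfl, hxy, hx⟩
    refine ⟨(hadds.aS3_mem.1 hb).resolve_left fun h => ?_, x, y, z, rfl, hR3.1 hxy,
      fun h => hx (hadds.aS3_mem.2 (.inr h))⟩
    obtain ⟨rfl, rfl, rfl⟩ := aS3_inj.1 h
    exact hx hb
  · rintro ⟨x, y, z, h, -, hx⟩
    obtain ⟨rfl, -, -⟩ := aS3_inj.1 h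
    exact hx (hadds.aS3_mem.2 (.inl rfl))

/-- All rules except possibly `ruleA` are satisfied. -/
structure AlmostModel (Q : FactBase) : Prop extends Ready Q where
  satR : SatR Q
  satS : SatS Q
  satLoop : SatLoop Q
  satProp : SatProp Q

theorem exists_almostModel {Q : FactBase} (hQ : Ready Q) (hR : SatR Q) (hS : SatS Q)
    (hL : SatLoop Q) : ∃ Q', Reach (twoAd R13set) Q Q' ∧ AlmostModel Q' := by
  suffices h : ∃ Q', Reach (twoAd R13set) Q Q' ∧
      (Ready Q' ∧ SatR Q' ∧ SatS Q' ∧ SatLoop Q') ∧ SatProp Q' by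
    obtain ⟨Q', hreach, ⟨hQ, hR, hS, hL⟩, hP⟩ := h
    exact ⟨Q', hreach, hQ, hR, hS, hL, hP⟩
  refine exists_reach_good (P := fun Q => Ready Q ∧ SatR Q ∧ SatS Q ∧ SatLoop Q)
    (fun Q a => ∃ u v, a = aS3 u u v ∧ aA v ∉ Q)
    (fun Q ⟨hQ, hR, hS, hL⟩ hno => ?_) ⟨hQ, hR, hS, hL⟩
  simp only [SatProp, not_forall] at hno
  obtain ⟨u, v, hm, hm', hno⟩ := hno
  obtain ⟨Q', hadds⟩ := hQ.weaklyReady.exists_adds_ruleProp hm hm'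
  have hR3 : ∀ {x y z}, aR3 x y z ∈ Q' ↔ aR3 x y z ∈ Q := by
    simp [hadds.aR3_mem, aA_ne_aR3.symm]
  have hS3 : ∀ {x y z}, aS3 x y z ∈ Q' ↔ aS3 x y z ∈ Q := by
    simp [hadds.aS3_mem, aA_ne_aS3.symm]
  refine ⟨Q', hadds.reach, ⟨hadds.ready hQ, ?_, ?_, ?_⟩, ?_, _, hm', ⟨u, v, rfl, hno⟩, ?_⟩
  · simpa only [SatR, hR3] using hR
  · simpa only [SatS, hR3, hS3] using hS
  · simpa only [SatLoop, hR3, hS3] using hL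
  · rintro _ hb ⟨x, y, rfl, hy⟩
    exact ⟨hS3.1 hb, x, y, rfl, fun h => hy (hadds.aA_mem.2 (.inr h))⟩
  · rintro ⟨x, y, h, hy⟩
    obtain ⟨-, -, rfl⟩ := aS3_inj.1 h
    exact hy (hadds.aA_mem.2 (.inl rfl))

/-- Once `ruleA` has introduced `R(u,y,z)` but not yet `R(u,u,u)`, the atom `S(u,u,u)` can be
obtained while satisfying all rules over `R` and `S`. -/
theorem AlmostModel.exists_evolves_loop {Q Q₁ : FactBase} (hQ : AlmostModel Q)
    (hQ₁ : WeaklyReady Q₁) {u y z : Term} (hy : y ≠ u)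
    (hmem : ∀ a : Atom, a.pred ≤ 2 → (a ∈ Q₁ ↔ a = aR3 u y z ∨ a ∈ Q)) :
    ∃ Q₂, Evolves Q₁ Q₂ ∧ (∀ x, aA x ∈ Q₂ ↔ aA x ∈ Q) ∧ SatR Q₂ ∧ SatS Q₂ ∧ SatLoop Q₂ ∧
      aS3 u u u ∈ Q₂ ∧ ∀ x w, aS3 x x w ∈ Q₂ → aS3 x x w ∈ Q ∨ w = x := by
  have hA₁ : ∀ {v}, aA v ∈ Q₁ ↔ aA v ∈ Q := by
    intro v
    simp [hmem (aA v) (by simp [aA]), aA_ne_aR3]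
  have hR₁ : ∀ {v w t}, aR3 v w t ∈ Q₁ ↔ (v = u ∧ w = y ∧ t = z) ∨ aR3 v w t ∈ Q := by
    intro v w t
    rw [hmem _ (by simp [aR3]), aR3_inj]
  have hS₁ : ∀ {v w t}, aS3 v w t ∈ Q₁ ↔ aS3 v w t ∈ Q := by
    intro v w t
    simp [hmem (aS3 v w t) (by simp [aS3]), aR3_ne_aS3.symm]
  by_cases hex : ∃ t, aR3 u u t ∈ Q
  · obtain ⟨t, ht⟩ := hex
    obtain ⟨s, hs⟩ := hQ.satS _ _ ht
    have huu : ∀ {x v}, aR3 x x v ∈ Q₁ ↔ aR3 x x v ∈ Q := by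
      intro x v
      rw [hR₁]
      refine or_iff_right ?_
      rintro ⟨rfl, rfl, -⟩
      exact hy rfl
    refine ⟨Q₁, .refl _, fun _ => hA₁, fun x v w h => ?_, ?_, ?_,
      hS₁.2 (hQ.satLoop _ _ _ ht hs), fun x w h => .inl (hS₁.1 h)⟩
    · rcases hR₁.1 h with ⟨rfl, -, -⟩ | h
      · exact ⟨t, hR₁.2 (.inr ht)⟩
      · obtain ⟨t, ht⟩ := hQ.satR _ _ _ h
        exact ⟨t, hR₁.2 (.inr ht)⟩
    · simpa only [SatS, huu, hS₁] using hQ.satS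
    · simpa only [SatLoop, huu, hS₁] using hQ.satLoop
  · have hno : ∀ v w, aR3 u v w ∉ Q := fun v w h => hex (hQ.satR _ _ _ h)
    have huyz : aR3 u y z ∈ Q₁ := hR₁.2 (.inl ⟨rfl, rfl, rfl⟩)
    obtain ⟨t, Q₂, ht, h₂⟩ := hQ₁.exists_adds_ruleR huyz (by
      rintro t ht
      rcases hR₁.1 ht with ⟨-, h, -⟩ | h
      exacts [hy h.symm, hno _ _ h])
    have htu := (var_ne_of_aR3_mem huyz ht).1
    have hQ₂ := h₂.weaklyReady hQ₁
    have hRt : aR3 u u (.var t) ∈ Q₂ := h₂.aR3_mem.2 (.inl rfl)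
    obtain ⟨s, Q₃, -, h₃⟩ := hQ₂.exists_adds_ruleS hRt (by
      rintro s hs
      rcases h₂.aS3_mem.1 hs with h | h
      exacts [aR3_ne_aS3 h.symm, (var_ne_of_aS3_mem h ht).2.1 rfl])
    have hQ₃ := h₃.weaklyReady hQ₂
    obtain ⟨Q₄, h₄⟩ := hQ₃.exists_adds_ruleLoop (h₃.aR3_mem.2 (.inr hRt))
      (h₃.aS3_mem.2 (.inl rfl))
    have hA : ∀ {v}, aA v ∈ Q₄ ↔ aA v ∈ Q := by
      intro v
      simp [h₄.aA_mem, h₃.aA_mem, h₂.aA_mem, hA₁, aA_ne_aR3, aA_ne_aS3]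
    have hR : ∀ {v w r}, aR3 v w r ∈ Q₄ ↔ (v = u ∧ w = u ∧ r = .var t) ∨
        (v = u ∧ w = y ∧ r = z) ∨ aR3 v w r ∈ Q := by
      intro v w r
      simp [h₄.aR3_mem, h₃.aR3_mem, h₂.aR3_mem, hR₁, aR3_ne_aS3, aR3_inj]
    have hS : ∀ {v w r}, aS3 v w r ∈ Q₄ ↔ (v = u ∧ w = u ∧ r = u) ∨
        (v = u ∧ w = .var t ∧ r = .var s) ∨ aS3 v w r ∈ Q := by
      intro v w r
      simp [h₄.aS3_mem, h₃.aS3_mem, h₂.aS3_mem, hS₁, aR3_ne_aS3.symm, aS3_inj]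
    have huuu : aS3 u u u ∈ Q₄ := hS.2 (.inl ⟨rfl, rfl, rfl⟩)
    refine ⟨Q₄, (h₂.trans h₃.toEvolves).trans h₄.toEvolves, fun _ => hA, fun x v w h => ?_,
      fun x v h => ?_, fun x v w h h' => ?_, huuu, fun x w h => ?_⟩
    · by_cases hx : x = u
      · exact ⟨.var t, hR.2 (.inl ⟨hx, hx, rfl⟩)⟩
      · obtain ⟨r, hr⟩ := hQ.satR x v w (by simpa [hR, hx] using h)
        exact ⟨r, hR.2 (.inr (.inr hr))⟩
    · rcases hR.1 h with ⟨rfl, -, rfl⟩ | ⟨rfl, rfl, -⟩ | h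
      · exact ⟨_, hS.2 (.inr (.inl ⟨rfl, rfl, rfl⟩))⟩
      · exact absurd rfl hy
      · obtain ⟨r, hr⟩ := hQ.satS x v h
        exact ⟨r, hS.2 (.inr (.inr hr))⟩
    · by_cases hx : x = u
      · rw [hx]
        exact huuu
      · exact hS.2 (.inr (.inr (hQ.satLoop x v w (by simpa [hR, hx] using h)
          (by simpa [hS, hx] using h'))))
    · rcases hS.1 h with ⟨rfl, -, rfl⟩ | ⟨rfl, h, -⟩ | h
      · exact .inr rfl
      · exact absurd h.symm htu
      · exact .inl h

theorem AlmostModel.exists_reach_loop {Q : FactBase} (hQ : AlmostModel Q) {u : Term}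
    (hu : aA u ∈ Q) (hno : aR3 u u u ∉ Q) :
    ∃ Q', Reach (twoAd R13set) Q Q' ∧ AlmostModel Q' ∧ (∀ x, aA x ∈ Q' ↔ aA x ∈ Q) ∧
      aR3 u u u ∈ Q' := by
  have hA : ruleA ∈ R13set := mem_R13set.2 (.inl rfl)
  have h0 : 0 ∈ FactBase.vars ruleA.body := mem_vars_body_ruleA.2 rfl
  obtain ⟨τ, n, hτ, hz, -, hreach⟩ := exists_reach_insert_xAtom hQ.stable hA
    (hQ.unfolded _ hA) (π := fun _ => u) (isHom_body_ruleA.2 hu) (by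
      rintro ⟨τ, hτ, hh⟩
      have := (isHom_head_ruleA.1 hh).1
      rw [hτ 0 h0] at this
      exact hno this)
  replace hτ : τ 0 = u := hτ 0 h0
  have hy : τ 1 ≠ u := by
    obtain ⟨h1, h1'⟩ := hz 1 (mem_exVars_ruleA.2 (.inl rfl))
    exact h1 ▸ var_ne_of_aA_mem hu h1'
  set X := (xAtom R13set ruleA).subst τ with hX
  have hpredR : ∀ x y z, (aR3 x y z).pred ∈ RuleSet.predsF R13set :=
    fun x y z => pred_mem_predsF_R13set (by simp [aR3])
  have hreach₁ : Reach (twoAd R13set) (insert X Q) (insert (aR3 u (τ 1) (τ 2)) (insert X Q)) := by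
    have := reach_insert_head hA (a := aR3 vx vy vz) (by simp [ruleA])
      (Finset.mem_insert_self X Q)
    rwa [aR3_subst, applyTerm_vx, applyTerm_vy, applyTerm_vz, hτ] at this
  have hQ₁ : WeaklyReady (insert (aR3 u (τ 1) (τ 2)) (insert X Q)) := by
    refine ⟨(hQ.stable.reach hreach).reach hreach₁, fun R hR hne => ?_⟩
    exact ((hQ.unfolded R hR).insert_ne hne.symm τ).union
      (S := {aR3 u (τ 1) (τ 2)}) (by simp [hpredR])
  obtain ⟨Q₂, hev, hA₂, hR₂, hS₂, hL₂, huuu, hloop⟩ := hQ.exists_evolves_loop hQ₁ hy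
    (z := τ 2) (fun a ha => by
      have : a ≠ X := xAtom_subst_ne (pred_mem_predsF_R13set ha)
      simp [this])
  have hXQ₂ : X ∈ Q₂ := hev.reach.subset (by simp)
  have hreach₂ : Reach (twoAd R13set) Q₂ (insert (aR3 u u u) Q₂) := by
    have := reach_insert_head hA (a := aR3 vx vx vx) (by simp [ruleA]) hXQ₂
    rwa [aR3_subst, applyTerm_vx, hτ] at this
  have hreach' : Reach (twoAd R13set) Q (insert (aR3 u u u) Q₂) :=
    hreach.trans (hreach₁.trans (hev.reach.trans hreach₂))
  have hunf : Unfolded R13set ruleA (insert (aR3 u u u) Q₂) := by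
    intro ρ hρ
    have hρ₂ := (Finset.mem_insert.1 hρ).resolve_left (xAtom_subst_ne (hpredR _ _ _)).symm
    rcases Finset.mem_insert.1 (hev.xAtom_mem ρ hρ₂) with h | h
    · exact absurd h (xAtom_subst_ne (hpredR _ _ _)).symm
    rcases Finset.mem_insert.1 h with h | h
    · have hτhead : IsHom τ ↑ruleA.head (↑(insert (aR3 u u u) Q₂) : Set Atom) := by
        rw [isHom_head_ruleA, hτ]
        exact ⟨Finset.mem_insert_self _ _,
          Finset.mem_insert_of_mem (hev.reach.subset (Finset.mem_insert_self _ _))⟩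
      exact hτhead.congr (xAtom_subst_inj h).2
    · exact (hQ.unfolded _ hA ρ h).mono (Finset.coe_subset.2 hreach'.subset)
  have hAm : ∀ {x}, aA x ∈ insert (aR3 u u u) Q₂ ↔ aA x ∈ Q := by
    simp [aA_ne_aR3, hA₂]
  have hRm : ∀ {x v w}, aR3 x v w ∈ insert (aR3 u u u) Q₂ ↔
      (x = u ∧ v = u ∧ w = u) ∨ aR3 x v w ∈ Q₂ := by simp [aR3_inj]
  have hSm : ∀ {x v w}, aS3 x v w ∈ insert (aR3 u u u) Q₂ ↔ aS3 x v w ∈ Q₂ := by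
    simp [aR3_ne_aS3.symm]
  refine ⟨_, hreach', ⟨⟨hQ.stable.reach hreach', fun R hR => ?_⟩, fun x v w h => ?_,
    fun x v h => ?_, fun x v w h h' => ?_, fun x w h h' => ?_⟩, fun x => hAm,
    Finset.mem_insert_self _ _⟩
  · by_cases hne : R = ruleA
    · rw [hne]
      exact hunf
    · exact ((hev.weaklyReady hQ₁).unfolded_of_ne R hR hne).union (S := {aR3 u u u})
        (by simp [hpredR])
  · rcases hRm.1 h with ⟨rfl, rfl, rfl⟩ | h
    · exact ⟨_, Finset.mem_insert_self _ _⟩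
    · obtain ⟨t, ht⟩ := hR₂ x v w h
      exact ⟨t, Finset.mem_insert_of_mem ht⟩
  · rcases hRm.1 h with ⟨rfl, -, rfl⟩ | h
    · exact ⟨_, hSm.2 huuu⟩
    · obtain ⟨t, ht⟩ := hS₂ x v h
      exact ⟨t, hSm.2 ht⟩
  · rcases hRm.1 h with ⟨rfl, -, rfl⟩ | h
    · exact hSm.2 huuu
    · exact hSm.2 (hL₂ x v w h (hSm.1 h'))
  · rw [hAm] at h ⊢
    rcases hloop x w (hSm.1 h') with h' | rfl
    · exact hQ.satProp x w h h'
    · exact h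

theorem AlmostModel.exists_satA {Q : FactBase} (hQ : AlmostModel Q) :
    ∃ Q', Reach (twoAd R13set) Q Q' ∧ AlmostModel Q' ∧ ∀ u, aA u ∈ Q' → aR3 u u u ∈ Q' := by
  refine exists_reach_good (fun Q a => ∃ u, a = aA u ∧ aR3 u u u ∉ Q) (fun Q hQ hno => ?_) hQ
  simp only [not_forall] at hno
  obtain ⟨u, hu, hno⟩ := hno
  obtain ⟨Q', hreach, hQ', hA, hR⟩ := hQ.exists_reach_loop hu hno
  refine ⟨Q', hreach, hQ', ?_, _, hu, ⟨u, rfl, hno⟩, ?_⟩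
  · rintro _ hb ⟨x, rfl, hx⟩
    exact ⟨(hA x).1 hb, x, rfl, fun h => hx (hreach.subset h)⟩
  · rintro ⟨x, h, hx⟩
    obtain rfl := aA_inj.1 h
    exact hx hR

theorem AlmostModel.satisfiesRule {Q : FactBase} (hQ : AlmostModel Q)
    (hA : ∀ u, aA u ∈ Q → aR3 u u u ∈ Q) : ∀ R ∈ R13set, SatisfiesRule ↑Q R := by
  intro R hR σ hσ
  rcases mem_R13set.1 hR with rfl | rfl | rfl | rfl | rfl
  · refine ⟨fun _ => σ 0, fun v hv => ?_, ?_⟩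
    · rw [mem_vars_body_ruleA.1 hv]
    · have := hA _ (isHom_body_ruleA.1 hσ)
      exact isHom_head_ruleA.2 ⟨this, this⟩
  · obtain ⟨t, ht⟩ := hQ.satR _ _ _ (isHom_body_ruleR.1 hσ)
    refine ⟨Function.update σ 3 t, fun v hv => Function.update_of_ne ?_ _ _, ?_⟩
    · rintro rfl
      simpa using mem_vars_body_ruleR.1 hv
    · exact isHom_head_ruleR.2 ht
  · obtain ⟨t, ht⟩ := hQ.satS _ _ (isHom_body_ruleS.1 hσ)
    refine ⟨Function.update σ 2 t, fun v hv => Function.update_of_ne ?_ _ _, ?_⟩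
    · rintro rfl
      simpa using mem_vars_body_ruleS.1 hv
    · exact isHom_head_ruleS.2 ht
  · obtain ⟨h, h'⟩ := isHom_body_ruleLoop.1 hσ
    exact ⟨σ, fun _ _ => rfl, isHom_head_ruleLoop.2 (hQ.satLoop _ _ _ h h')⟩
  · obtain ⟨h, h'⟩ := isHom_body_ruleProp.1 hσ
    exact ⟨σ, fun _ _ => rfl, isHom_head_ruleProp.2 (hQ.satProp _ _ h h')⟩

theorem ctex_twoAd_R13set : CTex Variant.R (twoAd R13set) := by
  refine ctex_iff.2 fun F => ?_
  obtain ⟨F₁, r₁, hst⟩ := exists_stable (twoAd R13set) F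
  obtain ⟨F₂, r₂, hunf⟩ := exists_reach_unfolded R13set F₁
  obtain ⟨F₃, r₃, h₃, hR⟩ := exists_satR ⟨hst.reach r₂, hunf⟩
  obtain ⟨F₄, r₄, ⟨h₄, hR⟩, hS⟩ := exists_satS h₃ hR
  obtain ⟨F₅, r₅, ⟨h₅, hR, hS⟩, hL⟩ := exists_satLoop h₄ hR hS
  obtain ⟨F₆, r₆, h₆⟩ := exists_almostModel h₅ hR hS hL
  obtain ⟨F₇, r₇, h₇, hA⟩ := h₆.exists_satA
  obtain ⟨F₈, r₈, hterm⟩ := exists_reach_terminal h₇.stable h₇.unfolded (h₇.satisfiesRule hA)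
  exact ⟨F₈, r₁.trans (r₂.trans (r₃.trans (r₄.trans (r₅.trans (r₆.trans (r₇.trans r₈)))))), hterm⟩

/-- The two-way atomic decomposition preserves
sometimes-termination of the restricted chase and may even gain it, with `R13set`
as a witness of gain. -/
theorem statement13 :
    (∀ 𝓡 : RuleSet, CTex Variant.R 𝓡 → CTex Variant.R (twoAd 𝓡)) ∧
    (∃ 𝓡 : RuleSet, ¬ CTex Variant.R 𝓡 ∧ CTex Variant.R (twoAd 𝓡)) ∧
    (¬ CTex Variant.R R13set ∧ CTex Variant.R (twoAd R13set)) := by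
  exact ⟨fun _ h => h.twoAd, ⟨R13set, not_ctex_R13set, ctex_twoAd_R13set⟩,
    not_ctex_R13set, ctex_twoAd_R13set⟩

end
end ExRules
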